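/- arXiv:2208.14712 — 3 statements merged into one kernel-verified Lean document; each statement's English description precedes it below -/
import Mathlib

section
/- Let B be a finite-dimensional algebra over a field k. If condition (CI) holds for B, then condition (CII) holds for B: every compactly Gorenstein-projective, compactly filtered B-module is projective. (Lemma 5.1(1).) -/
open CategoryTheory
/-! ## Gorenstein homological algebra -/

section Gorenstein

variable (B : Type) [Ring B]

/-- `G` is a Gorenstein-projective `B`-module: `G` is the kernel at degree `0` of an
exact complex `P•` of projective modules such that `Hom_B(P•, B)` is exact. -/
def IsGProj (G : ModuleCat.{0} B) : Prop :=
  ∃ (P : ℤ → ModuleCat.{0} B) (d : ∀ i : ℤ, P i ⟶ P (i + 1)),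
    (∀ i, Module.Projective B (P i)) ∧
    (∀ i, LinearMap.range (d i).hom = LinearMap.ker (d (i + 1)).hom) ∧
    (∀ (i : ℤ) (φ : P (i + 1) ⟶ ModuleCat.of B B),
      d i ≫ φ = 0 ↔ ∃ ψ : P (i + 1 + 1) ⟶ ModuleCat.of B B, φ = d (i + 1) ≫ ψ) ∧
    Nonempty (↥G ≃ₗ[B] ↥(LinearMap.ker (d 0).hom))

/-- `G` is a Gorenstein-injective `B`-module: `G` is the kernel at degree `0` of an
exact complex `I•` of injective modules such that `Hom_B(E, I•)` is exact for every
injective module `E`. -/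
def IsGInj (G : ModuleCat.{0} B) : Prop :=
  ∃ (I : ℤ → ModuleCat.{0} B) (d : ∀ i : ℤ, I i ⟶ I (i + 1)),
    (∀ i, Module.Injective B ↥(I i)) ∧
    (∀ i, LinearMap.range (d i).hom = LinearMap.ker (d (i + 1)).hom) ∧
    (∀ (E : ModuleCat.{0} B), Module.Injective B ↥E →
      ∀ (i : ℤ) (φ : E ⟶ I (i + 1)), φ ≫ d (i + 1) = 0 ↔ ∃ ψ : E ⟶ I i, φ = ψ ≫ d i) ∧
    Nonempty (↥G ≃ₗ[B] ↥(LinearMap.ker (d 0).hom))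

/-- vanishing of `Ext^n_B(X, Y)` -/
noncomputable def extZero' (n : ℕ) (X Y : ModuleCat.{0} B) : Prop :=
  Subsingleton (((Ext ℤ (ModuleCat.{0} B) n).obj (Opposite.op X)).obj Y)

/-- `B` is virtually Gorenstein. -/
noncomputable def VirtGorenstein : Prop :=
  ∀ X : ModuleCat.{0} B,
    (∀ G : ModuleCat.{0} B, IsGProj B G → ∀ n : ℕ, 1 ≤ n → extZero' B n G X) ↔
    (∀ E : ModuleCat.{0} B, IsGInj B E → ∀ n : ℕ, 1 ≤ n → extZero' B n X E)

/-- `X` has projective dimension at most `n`. -/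
def ProjDimLE : ℕ → ModuleCat.{0} B → Prop
  | 0, X => Module.Projective B X
  | n + 1, X => ∃ (P : ModuleCat.{0} B) (_ : Module.Projective B P) (g : P ⟶ X),
      Function.Surjective g ∧ ProjDimLE n (ModuleCat.of B ↥(LinearMap.ker g.hom))

/-- `X` has finite projective dimension. -/
def FiniteProjDim (X : ModuleCat.{0} B) : Prop :=
  ∃ n, ProjDimLE B n X

/-- `X` is compactly filtered: it carries an exhaustive ascending chain of submodules
whose subquotients are finitely generated of finite projective dimension. -/
def CompactlyFiltered (X : ModuleCat.{0} B) : Prop :=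
  ∃ F : ℕ → Submodule B ↥X,
    Monotone F ∧ F 0 = ⊥ ∧ (⨆ n, F n) = ⊤ ∧
      ∀ n, Module.Finite B
          (↥(F (n + 1)) ⧸ (Submodule.comap (F (n + 1)).subtype (F n))) ∧
        FiniteProjDim B (ModuleCat.of B
          (↥(F (n + 1)) ⧸ (Submodule.comap (F (n + 1)).subtype (F n))))

/-- `X` is countably generated. -/
def CountablyGenerated (X : ModuleCat.{0} B) : Prop :=
  ∃ s : Set ↥X, s.Countable ∧ Submodule.span B s = ⊤

/-- the subgroup of `Hom_B(X,Y)` generated by morphisms factoring through projectives. -/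
def projSub (X Y : ModuleCat.{0} B) : AddSubgroup (X ⟶ Y) :=
  AddSubgroup.closure {f : X ⟶ Y |
    ∃ (P : ModuleCat.{0} B) (_ : Module.Projective B P) (g : X ⟶ P) (h : P ⟶ Y), f = g ≫ h}

/-- the stable Hom-group `StHom_B(X,Y)` modulo projectives. -/
def StHomP (X Y : ModuleCat.{0} B) : Type :=
  (X ⟶ Y) ⧸ projSub B X Y

instance (X Y : ModuleCat.{0} B) : AddCommGroup (StHomP B X Y) :=
  inferInstanceAs (AddCommGroup ((X ⟶ Y) ⧸ projSub B X Y))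

/-- postcomposition as an additive map on Hom-groups. -/
def postCompHom' {Y Z : ModuleCat.{0} B} (X : ModuleCat.{0} B) (h : Y ⟶ Z) :
    (X ⟶ Y) →+ (X ⟶ Z) :=
  AddMonoidHom.mk' (fun f => f ≫ h) (fun f g => by simp [Preadditive.add_comp])

/-- postcomposition descends to the projectively stable Hom-groups. -/
def stpPostComp (X : ModuleCat.{0} B) {Y Z : ModuleCat.{0} B} (h : Y ⟶ Z) :
    StHomP B X Y →+ StHomP B X Z :=
  QuotientAddGroup.map _ _ (postCompHom' B X h) (by
    rw [projSub, AddSubgroup.closure_le]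
    rintro f ⟨P, hP, u, v, rfl⟩
    rw [SetLike.mem_coe, AddSubgroup.mem_comap]
    exact AddSubgroup.subset_closure ⟨P, hP, u, v ≫ h, by simp [postCompHom']⟩)

/-- the canonical map `⊕ᵢ StHom_B(X, Y i) → StHom_B(X, ⊕ᵢ Y i)`. -/
noncomputable def stpCanonMap (X : ModuleCat.{0} B) (I : Type) (Y : I → ModuleCat.{0} B) :
    DirectSum I (fun i => StHomP B X (Y i)) →+ StHomP B X (∐ Y) :=
  letI : DecidableEq I := Classical.decEq I
  DirectSum.toAddMonoid fun i => stpPostComp B X (Limits.Sigma.ι Y i)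

/-- `G` is compactly Gorenstein-projective: `G` is Gorenstein-projective and compact in
the stable category of Gorenstein-projective modules. -/
noncomputable def CompactlyGProj (G : ModuleCat.{0} B) : Prop :=
  IsGProj B G ∧
    ∀ (I : Type) (Z : I → ModuleCat.{0} B), (∀ i, IsGProj B (Z i)) →
      Function.Bijective (stpCanonMap B G I Z)

/-- Condition (CI): the direct sum of countably many finitely generated modules of
finite projective dimension is right `Ext`-orthogonal to all countably generated,
compactly Gorenstein-projective modules. -/
noncomputable def CondCI : Prop :=
  ∀ Y : ℕ → ModuleCat.{0} B,
    (∀ n, Module.Finite B (Y n) ∧ FiniteProjDim B (Y n)) →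
      ∀ G : ModuleCat.{0} B, CountablyGenerated B G → CompactlyGProj B G →
        ∀ i : ℕ, 1 ≤ i → extZero' B i G (∐ Y)

/-- Condition (CII): every compactly Gorenstein-projective, compactly filtered module
is projective. -/
noncomputable def CondCII : Prop :=
  ∀ X : ModuleCat.{0} B, CompactlyGProj B X → CompactlyFiltered B X →
    Module.Projective B X

/-- `B` has infinite dominant dimension: there is an exact sequence
`0 → B → I⁰ → I¹ → ⋯` with all `Iⁿ` projective-injective. -/
def InfiniteDomDim : Prop :=
  ∃ (I : ℕ → ModuleCat.{0} B) (d0 : ModuleCat.of B B ⟶ I 0) (d : ∀ n, I n ⟶ I (n + 1)),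
    (∀ n, Module.Injective B ↥(I n) ∧ Module.Projective B ↥(I n)) ∧
    Function.Injective d0 ∧ LinearMap.range d0.hom = LinearMap.ker (d 0).hom ∧
    ∀ n, LinearMap.range (d n).hom = LinearMap.ker (d (n + 1)).hom

/-- `B` has finite finitistic dimension. -/
def FiniteFinitisticDim : Prop :=
  ∃ d : ℕ, ∀ X : ModuleCat.{0} B, Module.Finite B X → FiniteProjDim B X → ProjDimLE B d X

end Gorenstein


section Splitting

variable {C : Type*} [Category* C] [Abelian C] [EnoughProjectives C]

/-- If `Ext¹(X, Y)` vanishes, every short exact sequence `0 → Y → E → X → 0` splits. -/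
theorem CategoryTheory.ShortComplex.ShortExact.exists_section_of_subsingleton_ext
    {S : ShortComplex C} (hS : S.ShortExact)
    (h : Subsingleton (((Ext ℤ C 1).obj (Opposite.op S.X₃)).obj S.X₁)) :
    ∃ r : S.X₃ ⟶ S.X₂, r ≫ S.g = 𝟙 S.X₃ := by
  have := hS.mono_f
  have := hS.epi_g
  let P := ProjectiveResolution.of S.X₃
  obtain ⟨π, hπ, hd, hdesc⟩ : ∃ π : P.complex.X 0 ⟶ S.X₃, Epi π ∧ P.complex.d 1 0 ≫ π = 0 ∧
      ∀ u : P.complex.X 0 ⟶ S.X₂, P.complex.d 1 0 ≫ u = 0 → ∃ v, π ≫ v = u :=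
    ⟨P.π.f 0, inferInstanceAs (Epi (P.π.f 0)), P.complex_d_comp_π_f_zero,
      fun u hu => ⟨P.exact₀.desc u hu, P.exact₀.g_desc u hu⟩⟩
  have key : ∀ φ : P.complex.X 1 ⟶ S.X₁, P.complex.d 2 1 ≫ φ = 0 →
      ∃ η : P.complex.X 0 ⟶ S.X₁, P.complex.d 1 0 ≫ η = φ := by
    have hz : (P.complex.linearYonedaObj ℤ S.X₁).ExactAt 1 := by
      rw [HomologicalComplex.exactAt_iff_isZero_homology]
      exact Limits.IsZero.of_iso (ModuleCat.isZero_of_subsingleton _)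
        (P.isoExt (R := ℤ) 1 S.X₁).symm
    rw [HomologicalComplex.exactAt_iff' _ 0 1 2 (by simp) (by simp),
      ShortComplex.moduleCat_exact_iff] at hz
    exact fun φ hφ => hz φ hφ
  let l : P.complex.X 0 ⟶ S.X₂ := Projective.factorThru π S.g
  have hl : l ≫ S.g = π := Projective.factorThru_comp _ _
  have hdl : (P.complex.d 1 0 ≫ l) ≫ S.g = 0 := by
    rw [Category.assoc, hl, hd]
  let φ := hS.exact.lift _ hdl
  have hφ : φ ≫ S.f = P.complex.d 1 0 ≫ l := hS.exact.lift_f _ _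
  obtain ⟨η, hη⟩ := key φ (by
    rw [← cancel_mono S.f, Category.assoc, hφ]
    simp)
  have hdes : P.complex.d 1 0 ≫ (l - η ≫ S.f) = 0 := by
    rw [Preadditive.comp_sub, ← Category.assoc, hη, hφ, sub_self]
  obtain ⟨r, hr⟩ := hdesc _ hdes
  refine ⟨r, ?_⟩
  rw [← cancel_epi π, ← Category.assoc, hr, Preadditive.sub_comp, hl, Category.assoc, S.zero,
    Limits.comp_zero, sub_zero, Category.comp_id]

end Splitting

section ProjectiveDimension

variable {B : Type} [Ring B]

theorem shortExact_of_exact {M N L : Type} [AddCommGroup M] [AddCommGroup N]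
    [AddCommGroup L] [Module B M] [Module B N] [Module B L] (f : M →ₗ[B] N) (g : N →ₗ[B] L)
    (hf : Function.Injective f) (hg : Function.Surjective g) (h : Function.Exact f g) :
    (ShortComplex.mk (ModuleCat.ofHom f) (ModuleCat.ofHom g)
      (by ext x; exact h.apply_apply_eq_zero x)).ShortExact where
  exact := by
    rw [ShortComplex.moduleCat_exact_iff]
    exact fun x hx => (h x).1 hx
  mono_f := (ModuleCat.mono_iff_injective _).2 hf
  epi_g := (ModuleCat.epi_iff_surjective _).2 hg

theorem shortExact_ker {N L : Type} [AddCommGroup N]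
    [AddCommGroup L] [Module B N] [Module B L] (g : N →ₗ[B] L)
    (hg : Function.Surjective g) :
    (ShortComplex.mk (ModuleCat.ofHom (LinearMap.ker g).subtype) (ModuleCat.ofHom g)
      (by ext x; exact x.2)).ShortExact :=
  shortExact_of_exact _ g Subtype.val_injective hg
    (LinearMap.exact_subtype_ker_map g)

theorem hasProjectiveDimensionLT_ker {N L : Type} [AddCommGroup N] [AddCommGroup L] [Module B N]
    [Module B L] [Module.Projective B N] (g : N →ₗ[B] L) (hg : Function.Surjective g) (n : ℕ) :
    HasProjectiveDimensionLT (ModuleCat.of B L) (n + 2) ↔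
      HasProjectiveDimensionLT (ModuleCat.of B (LinearMap.ker g)) (n + 1) :=
  (shortExact_ker g hg).hasProjectiveDimensionLT_X₃_iff n
    ((IsProjective.iff_projective N).1 inferInstance)

theorem projDimLE_iff (n : ℕ) (X : ModuleCat.{0} B) :
    ProjDimLE B n X ↔ HasProjectiveDimensionLT X (n + 1) := by
  induction n generalizing X with
  | zero =>
    rw [ProjDimLE, ← projective_iff_hasProjectiveDimensionLT_one]
    exact IsProjective.iff_projective X
  | succ n ih =>
    constructor
    · rintro ⟨P, hP, g, hg, h⟩
      exact (hasProjectiveDimensionLT_ker g.hom hg n).2 ((ih _).1 h)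
    · intro h
      refine ⟨ModuleCat.of B (X →₀ B), inferInstanceAs (Module.Projective B (X →₀ B)),
        ModuleCat.ofHom (Finsupp.linearCombination B id),
        Finsupp.linearCombination_id_surjective B X, (ih _).2 ?_⟩
      exact (hasProjectiveDimensionLT_ker _
        (Finsupp.linearCombination_id_surjective B X) n).1 h

theorem FiniteProjDim.of_exact {M N L : Type} [AddCommGroup M] [AddCommGroup N]
    [AddCommGroup L] [Module B M] [Module B N] [Module B L] (f : M →ₗ[B] N) (g : N →ₗ[B] L)
    (hf : Function.Injective f) (hg : Function.Surjective g) (h : Function.Exact f g)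
    (hM : FiniteProjDim B (ModuleCat.of B M)) (hL : FiniteProjDim B (ModuleCat.of B L)) :
    FiniteProjDim B (ModuleCat.of B N) := by
  obtain ⟨m, hm⟩ := hM
  obtain ⟨l, hl⟩ := hL
  rw [projDimLE_iff] at hm hl
  refine ⟨max m l, (projDimLE_iff _ _).2 ?_⟩
  exact (shortExact_of_exact f g hf hg h).hasProjectiveDimensionLT_X₂ _
    (hasProjectiveDimensionLT_of_ge _ (m + 1) _ (by simp))
    (hasProjectiveDimensionLT_of_ge _ (l + 1) _ (by simp))

end ProjectiveDimension

section Lifting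

variable {B : Type} [Ring B]

theorem exists_eq_comp_of_finite_projective {M N L Y : Type} [AddCommGroup M] [AddCommGroup N]
    [AddCommGroup L] [AddCommGroup Y] [Module B M] [Module B N] [Module B L] [Module B Y]
    [Module.Finite B Y] [Module.Projective B Y] (f : M →ₗ[B] N) (g : N →ₗ[B] L)
    (h : ∀ φ : N →ₗ[B] B, φ ∘ₗ f = 0 → ∃ ψ : L →ₗ[B] B, φ = ψ ∘ₗ g)
    (φ : N →ₗ[B] Y) (hφ : φ ∘ₗ f = 0) : ∃ ψ : L →ₗ[B] Y, φ = ψ ∘ₗ g := by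
  obtain ⟨m, p, hp⟩ := Module.Finite.exists_fin' B Y
  obtain ⟨i, hi⟩ := Module.projective_lifting_property p LinearMap.id hp
  choose ψ hψ using fun j : Fin m => h (LinearMap.proj j ∘ₗ i ∘ₗ φ) (by
    rw [LinearMap.comp_assoc, LinearMap.comp_assoc, hφ, LinearMap.comp_zero, LinearMap.comp_zero])
  refine ⟨p ∘ₗ LinearMap.pi ψ, ?_⟩
  have hpi : i ∘ₗ φ = LinearMap.pi ψ ∘ₗ g := by
    ext x j
    exact LinearMap.congr_fun (hψ j) x
  rw [LinearMap.comp_assoc, ← hpi, ← LinearMap.comp_assoc, hi, LinearMap.id_comp]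

/-- The `Hom` complex from a totally acyclic complex of projectives into a finitely generated
module of finite projective dimension is exact. -/
theorem exists_eq_comp_of_hasProjectiveDimensionLT [IsNoetherianRing B]
    (P : ℤ → ModuleCat.{0} B) (d : ∀ i : ℤ, P i ⟶ P (i + 1))
    (hP : ∀ i, Module.Projective B (P i))
    (hd : ∀ i, LinearMap.range (d i).hom = LinearMap.ker (d (i + 1)).hom)
    (hB : ∀ (i : ℤ) (φ : P (i + 1) →ₗ[B] B), φ ∘ₗ (d i).hom = 0 →
      ∃ ψ : P (i + 1 + 1) →ₗ[B] B, φ = ψ ∘ₗ (d (i + 1)).hom)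
    (n : ℕ) (Y : Type) [AddCommGroup Y] [Module B Y] [Module.Finite B Y]
    (hY : HasProjectiveDimensionLT (ModuleCat.of B Y) (n + 1)) (i : ℤ)
    (φ : P (i + 1) →ₗ[B] Y) (hφ : φ ∘ₗ (d i).hom = 0) :
    ∃ ψ : P (i + 1 + 1) →ₗ[B] Y, φ = ψ ∘ₗ (d (i + 1)).hom := by
  induction n generalizing Y i with
  | zero =>
    have : Module.Projective B Y :=
      (IsProjective.iff_projective Y).2 (projective_iff_hasProjectiveDimensionLT_one.2 hY)
    exact exists_eq_comp_of_finite_projective _ _ (hB i) φ hφ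
  | succ n ih =>
    obtain ⟨m, p, hp⟩ := Module.Finite.exists_fin' B Y
    have hK := (hasProjectiveDimensionLT_ker p hp n).1 hY
    obtain ⟨g, hg⟩ := Module.projective_lifting_property p φ hp
    obtain ⟨j, rfl⟩ : ∃ j, i = j + 1 := ⟨i - 1, by simp⟩
    have hgd : ∀ x, (g ∘ₗ (d (j + 1)).hom) x ∈ LinearMap.ker p := fun x => by
      have h₁ := LinearMap.congr_fun hg ((d (j + 1)).hom x)
      have h₂ := LinearMap.congr_fun hφ x
      exact h₁.trans h₂
    obtain ⟨η, hη⟩ := ih (LinearMap.ker p) hK j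
      (LinearMap.codRestrict (LinearMap.ker p) (g ∘ₗ (d (j + 1)).hom) hgd) (by
        ext1 x
        have hx : (d (j + 1)).hom ((d j).hom x) = 0 :=
          LinearMap.mem_ker.1 (hd j ▸ LinearMap.mem_range_self _ x)
        apply Subtype.ext
        simp [hx])
    obtain ⟨ψ, hψ⟩ := exists_eq_comp_of_finite_projective _ _ (hB (j + 1))
      (g - (LinearMap.ker p).subtype ∘ₗ η) (by
        ext1 x
        have hx := congrArg Subtype.val (LinearMap.congr_fun hη x)
        exact sub_eq_zero.2 hx)
    refine ⟨p ∘ₗ ψ, ?_⟩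
    rw [LinearMap.comp_assoc, ← hψ, LinearMap.comp_sub, hg, ← LinearMap.comp_assoc,
      LinearMap.comp_ker_subtype, LinearMap.zero_comp, sub_zero]

/-- A Gorenstein-projective module maps to a projective module so that every homomorphism to a
finitely generated module of finite projective dimension factors through this map. -/
theorem IsGProj.exists_projective_preenvelope [IsNoetherianRing B] {G : ModuleCat.{0} B}
    (hG : IsGProj B G) :
    ∃ (Q : ModuleCat.{0} B) (a : G →ₗ[B] Q), Module.Projective B Q ∧
      ∀ (Y : Type) [AddCommGroup Y] [Module B Y] [Module.Finite B Y],
        FiniteProjDim B (ModuleCat.of B Y) → ∀ f : G →ₗ[B] Y, ∃ g : Q →ₗ[B] Y, f = g ∘ₗ a := by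
  obtain ⟨P, d, hP, hd, hB, ⟨e⟩⟩ := hG
  generalize (0 : ℤ) = i at e
  obtain ⟨j, rfl⟩ : ∃ j, i = j + 1 + 1 := ⟨i - 1 - 1, by simp⟩
  refine ⟨P (j + 1 + 1), (LinearMap.ker (d (j + 1 + 1)).hom).subtype ∘ₗ e.toLinearMap,
    hP _, fun Y _ _ _ hY f => ?_⟩
  obtain ⟨n, hn⟩ := hY
  have hrange : ∀ i x, (d i).hom x ∈ LinearMap.ker (d (i + 1)).hom := fun i x =>
    hd i ▸ LinearMap.mem_range_self _ x
  obtain ⟨ψ, hψ⟩ := exists_eq_comp_of_hasProjectiveDimensionLT P d hP hd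
    (fun i φ hφ => by
      obtain ⟨ψ, hψ⟩ := (hB i (ModuleCat.ofHom φ)).1 (ModuleCat.hom_ext hφ)
      exact ⟨ψ.hom, congrArg ModuleCat.Hom.hom hψ⟩)
    n Y ((projDimLE_iff _ _).1 hn) j
    (f ∘ₗ e.symm.toLinearMap ∘ₗ LinearMap.codRestrict _ (d (j + 1)).hom (hrange (j + 1)))
    (by
      ext1 x
      have hx : LinearMap.codRestrict _ (d (j + 1)).hom (hrange (j + 1)) ((d j).hom x) = 0 :=
        Subtype.ext (hrange j x)
      simp [hx])
  refine ⟨ψ, ?_⟩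
  ext1 x
  obtain ⟨y, hy⟩ : (e x : P (j + 1 + 1)) ∈ LinearMap.range (d (j + 1)).hom := by
    rw [hd]
    exact (e x).2
  have hy' : LinearMap.codRestrict _ (d (j + 1)).hom (hrange (j + 1)) y = e x := Subtype.ext hy
  have := LinearMap.congr_fun hψ y
  simp only [LinearMap.comp_apply, hy', hy] at this
  simpa using this

end Lifting

section Telescope

open DirectSum

variable {R X : Type*} [Ring R] [AddCommGroup X] [Module R X]

/-- The sum map from the direct sum of a family of submodules. -/
def sumMap (F : ℕ → Submodule R X) : (⨁ n, F n) →ₗ[R] X :=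
  DirectSum.toModule R ℕ X fun n => (F n).subtype

/-- The map `1 - shift` on the direct sum of an ascending chain of submodules. -/
def telescopeMap {F : ℕ → Submodule R X} (hF : Monotone F) : (⨁ n, F n) →ₗ[R] ⨁ n, F n :=
  DirectSum.toModule R ℕ _ fun n => lof R ℕ (fun n => F n) n -
    lof R ℕ (fun n => F n) (n + 1) ∘ₗ Submodule.inclusion (hF n.le_succ)

variable {F : ℕ → Submodule R X} (hF : Monotone F)

theorem telescopeMap_lof (n : ℕ) (x : F n) : telescopeMap hF (lof R ℕ (fun n => F n) n x) =
    lof R ℕ (fun n => F n) n x -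
      lof R ℕ (fun n => F n) (n + 1) (Submodule.inclusion (hF n.le_succ) x) := by
  simp [telescopeMap]

theorem sumMap_lof (n : ℕ) (x : F n) : sumMap F (lof R ℕ (fun n => F n) n x) = x := by
  simp [sumMap]

theorem sumMap_telescopeMap (y : ⨁ n, F n) : sumMap F (telescopeMap hF y) = 0 := by
  induction y using DirectSum.induction_on with
  | zero => simp
  | of n x =>
    change sumMap F (telescopeMap hF (lof R ℕ (fun n => F n) n x)) = 0
    rw [telescopeMap_lof, map_sub, sumMap_lof, sumMap_lof]
    simp
  | add y z hy hz => rw [map_add, map_add, hy, hz, add_zero]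

theorem telescopeMap_apply_zero (y : ⨁ n, F n) : telescopeMap hF y 0 = y 0 := by
  induction y using DirectSum.induction_on with
  | zero => simp
  | of n x =>
    change telescopeMap hF (lof R ℕ (fun n => F n) n x) 0 = _
    rw [telescopeMap_lof, DirectSum.sub_apply, lof_eq_of, lof_eq_of,
      DirectSum.of_eq_of_ne (n + 1) 0 _ (by simp), sub_zero]
  | add y z hy hz => simp [hy, hz]

theorem telescopeMap_apply_succ (y : ⨁ n, F n) (m : ℕ) :
    telescopeMap hF y (m + 1) = y (m + 1) - Submodule.inclusion (hF m.le_succ) (y m) := by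
  induction y using DirectSum.induction_on with
  | zero => simp
  | of n x =>
    change telescopeMap hF (lof R ℕ (fun n => F n) n x) (m + 1) = _
    rw [telescopeMap_lof, DirectSum.sub_apply, lof_eq_of, lof_eq_of]
    congr 1
    by_cases h : n = m
    · subst h
      simp
    · rw [DirectSum.of_eq_of_ne _ _ _ (by omega), DirectSum.of_eq_of_ne _ _ _ (by omega), map_zero]
  | add y z hy hz =>
    rw [map_add, DirectSum.add_apply, hy, hz, DirectSum.add_apply, DirectSum.add_apply, map_add]
    abel

theorem telescopeMap_injective : Function.Injective (telescopeMap hF) := by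
  rw [injective_iff_map_eq_zero]
  intro y hy
  ext m : 1
  induction m with
  | zero => rw [← telescopeMap_apply_zero hF, hy]
  | succ m ih =>
    have h := telescopeMap_apply_succ hF y m
    rw [hy, ih] at h
    simpa using h.symm

theorem exists_sub_lof_mem_range_telescopeMap (y : ⨁ n, F n) :
    ∃ N, ∀ m ≥ N, ∃ x : F m, (x : X) = sumMap F y ∧
      y - lof R ℕ (fun n => F n) m x ∈ LinearMap.range (telescopeMap hF) := by
  induction y using DirectSum.induction_on with
  | zero => exact ⟨0, fun m _ => ⟨0, by simp, by simp⟩⟩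
  | of n x =>
    refine ⟨n, fun m hm => ⟨Submodule.inclusion (hF hm) x, (sumMap_lof n x).symm, ?_⟩⟩
    induction m, hm using Nat.le_induction with
    | base => exact ⟨0, by rw [map_zero]; exact (sub_self _).symm⟩
    | succ m hm ih =>
      have h := Submodule.add_mem _ ih
        ⟨lof R ℕ (fun n => F n) m (Submodule.inclusion (hF hm) x), telescopeMap_lof hF m _⟩
      rw [sub_add_sub_cancel] at h
      exact h
  | add y z hy hz =>
    obtain ⟨N, hN⟩ := hy
    obtain ⟨K, hK⟩ := hz
    refine ⟨max N K, fun m hm => ?_⟩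
    obtain ⟨u, hu, hu'⟩ := hN m (le_trans (le_max_left _ _) hm)
    obtain ⟨v, hv, hv'⟩ := hK m (le_trans (le_max_right _ _) hm)
    refine ⟨u + v, by simp [hu, hv], ?_⟩
    rw [map_add, add_sub_add_comm]
    exact Submodule.add_mem _ hu' hv'

theorem exact_telescopeMap_sumMap : Function.Exact (telescopeMap hF) (sumMap F) := by
  refine fun y => ⟨fun hy => ?_, ?_⟩
  · obtain ⟨N, hN⟩ := exists_sub_lof_mem_range_telescopeMap hF y
    obtain ⟨x, hx, h⟩ := hN N le_rfl
    rw [hy] at hx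
    obtain rfl : x = 0 := Subtype.ext hx
    simpa using h
  · rintro ⟨z, rfl⟩
    exact sumMap_telescopeMap hF z

theorem sumMap_surjective (hF' : ∀ x : X, ∃ n, x ∈ F n) : Function.Surjective (sumMap F) :=
  fun x => (hF' x).elim fun n hn => ⟨lof R ℕ (fun n => F n) n ⟨x, hn⟩, sumMap_lof n ⟨x, hn⟩⟩

end Telescope

section LocallyProjective

variable {R X Q : Type*} [Ring R] [AddCommGroup X] [Module R X] [AddCommGroup Q] [Module R Q]

/-- A module exhausted by a chain of submodules is projective if, on each of these submodules,
the identity agrees with an endomorphism which factors through a projective module and has image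
inside some member of the chain. -/
theorem Module.Projective.of_forall_exists_eqOn_chain [Module.Projective R Q]
    {F : ℕ → Submodule R X} (hF : Monotone F) (hF' : ∀ x : X, ∃ n, x ∈ F n) (a : X →ₗ[R] Q)
    (h : ∀ n, ∃ (b : Q →ₗ[R] X) (N : ℕ), (∀ x ∈ F n, b (a x) = x) ∧ ∀ x, b (a x) ∈ F N) :
    Module.Projective R X := by
  choose b N hb hN using h
  let K : ℕ → ℕ := fun n => Nat.rec 0 (fun _ m => max (m + 1) (N m)) n
  have hK : ∀ n, K (n + 1) = max (K n + 1) (N (K n)) := fun n => rfl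
  have hKmono : StrictMono K := strictMono_nat_of_lt_succ fun n => by
    rw [hK]
    omega
  have hfix : ∀ n x, b (K (n + 1)) (a (b (K n) (a x))) = b (K n) (a x) := fun n x =>
    hb _ _ (hF (by rw [hK]; exact le_max_right _ _) (hN (K n) x))
  let p : (X →₀ R) →ₗ[R] X := Finsupp.linearCombination R id
  have hp : Function.Surjective p := Finsupp.linearCombination_id_surjective R X
  choose c hc using fun n => Module.projective_lifting_property p (b (K n)) hp
  let σ : ℕ → X →ₗ[R] X →₀ R := fun n => Nat.rec (c 0 ∘ₗ a)
    (fun n s => s + c (n + 1) ∘ₗ a ∘ₗ (LinearMap.id - b (K n) ∘ₗ a)) n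
  have hσ : ∀ n x, σ (n + 1) x = σ n x + c (n + 1) (a (x - b (K n) (a x))) := fun n x => rfl
  have hpσ : ∀ n x, p (σ n x) = b (K n) (a x) := by
    intro n x
    have hpc : ∀ n q, p (c n q) = b (K n) q := fun n q => LinearMap.congr_fun (hc n) q
    induction n with
    | zero => exact hpc 0 (a x)
    | succ n ih => rw [hσ, map_add, ih, hpc, map_sub, map_sub, hfix, add_sub_cancel]
  have hstab : ∀ n x, x ∈ F n → ∀ m ≥ n, σ m x = σ n x := by
    intro n x hx m hm
    induction m, hm using Nat.le_induction with
    | base => rfl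
    | succ m hm ih =>
      rw [hσ, hb _ _ (hF (hm.trans hKmono.le_apply) hx), sub_self, map_zero, map_zero, add_zero, ih]
  choose ν hν using hF'
  have hlim : ∀ x n, x ∈ F n → σ (ν x) x = σ n x := fun x n hx => by
    rw [← hstab _ x (hν x) _ (le_max_left _ n), ← hstab _ x hx _ (le_max_right (ν x) _)]
  let s : X →ₗ[R] X →₀ R :=
    { toFun := fun x => σ (ν x) x
      map_add' := fun x y => by
        have hx := hF (le_max_left (ν x) (ν y)) (hν x)
        have hy := hF (le_max_right (ν x) (ν y)) (hν y)
        rw [hlim _ _ hx, hlim _ _ hy, hlim _ _ (Submodule.add_mem _ hx hy), map_add]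
      map_smul' := fun r x => by
        rw [hlim _ _ (Submodule.smul_mem _ r (hν x)), map_smul, RingHom.id_apply] }
  refine Module.Projective.of_split s p (LinearMap.ext fun x => ?_)
  exact (hpσ _ x).trans (hb _ _ (hF hKmono.le_apply (hν x)))

end LocallyProjective

section Filtered

variable {B : Type} [Ring B] {X : ModuleCat.{0} B}

theorem CompactlyFiltered.exists_chain (hX : CompactlyFiltered B X) :
    ∃ F : ℕ → Submodule B X, Monotone F ∧ (∀ x : X, ∃ n, x ∈ F n) ∧
      ∀ n, Module.Finite B (F n) ∧ FiniteProjDim B (ModuleCat.of B (F n)) := by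
  obtain ⟨F, hF, h0, htop, hq⟩ := hX
  refine ⟨F, hF, fun x => (Submodule.mem_iSup_of_directed F hF.directed_le).1
    (htop ▸ Submodule.mem_top), fun n => ?_⟩
  induction n with
  | zero =>
    rw [h0]
    exact ⟨inferInstance, 0, (inferInstance : Module.Projective B (⊥ : Submodule B X))⟩
  | succ n ih =>
    obtain ⟨ih₁, ih₂⟩ := ih
    obtain ⟨hq₁, hq₂⟩ := hq n
    have hexact : Function.Exact (Submodule.inclusion (hF n.le_succ))
        (Submodule.comap (F (n + 1)).subtype (F n)).mkQ := by
      rw [LinearMap.exact_iff, Submodule.ker_mkQ, Submodule.range_inclusion]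
    refine ⟨?_, FiniteProjDim.of_exact _ _ (Submodule.inclusion_injective _)
      (Submodule.mkQ_surjective _) hexact ih₂ hq₂⟩
    have : Module.Finite B (Submodule.comap (F (n + 1)).subtype (F n)) :=
      Module.Finite.equiv (Submodule.comapSubtypeEquivOfLe (hF n.le_succ)).symm
    exact Module.Finite.of_submodule_quotient (Submodule.comap (F (n + 1)).subtype (F n))

theorem CountablyGenerated.of_chain {F : ℕ → Submodule B X} (hF : ∀ x : X, ∃ n, x ∈ F n)
    (hfin : ∀ n, Module.Finite B (F n)) : CountablyGenerated B X := by
  choose s hs using fun n => Module.Finite.iff_fg.1 (hfin n)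
  refine ⟨⋃ n, (s n : Set X), Set.countable_iUnion fun n => (s n).countable_toSet, ?_⟩
  rw [Submodule.span_iUnion, eq_top_iff]
  rintro x -
  obtain ⟨n, hn⟩ := hF x
  rw [← hs n] at hn
  exact Submodule.mem_iSup_of_mem n hn

/-- A module which splits off the direct sum of a chain of finitely generated submodules of
finite projective dimension is projective as soon as it is Gorenstein-projective. -/
theorem IsGProj.projective_of_section [IsNoetherianRing B] (hX : IsGProj B X)
    {F : ℕ → Submodule B X} (hF : Monotone F) (hF' : ∀ x : X, ∃ n, x ∈ F n)
    (hfin : ∀ n, Module.Finite B (F n) ∧ FiniteProjDim B (ModuleCat.of B (F n)))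
    (r : X →ₗ[B] DirectSum ℕ fun n => F n) (hr : ∀ x, sumMap F (r x) = x) :
    Module.Projective B X := by
  obtain ⟨Q, a, hQ, ha⟩ := hX.exists_projective_preenvelope
  choose ψ hψ using fun n =>
    have := (hfin n).1
    ha (F n) (hfin n).2 (DirectSum.component B ℕ (fun n => F n) n ∘ₗ r)
  have hψ' : ∀ n x, ψ n (a x) = r x n := fun n x => (LinearMap.congr_fun (hψ n) x).symm
  have hbound : ∀ n, ∃ N, ∀ x ∈ F n, ∀ m ≥ N, r x m = 0 := by
    classical
    intro n
    obtain ⟨s, hs⟩ := Module.Finite.iff_fg.1 (hfin n).1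
    refine ⟨(s.biUnion fun x => (r x).support).sup id + 1, fun x hx m hm => ?_⟩
    rw [← hs] at hx
    induction hx using Submodule.span_induction with
    | mem x hx =>
      by_contra hne
      have hmem : m ∈ s.biUnion fun x => (r x).support :=
        Finset.mem_biUnion.2 ⟨x, hx, DFinsupp.mem_support_iff.2 hne⟩
      have := Finset.le_sup (f := id) hmem
      simp only [id] at this
      omega
    | zero => simp
    | add x y _ _ hx hy => rw [map_add, DirectSum.add_apply, hx, hy, add_zero]
    | smul c x _ hx => rw [map_smul, DirectSum.smul_apply, hx, smul_zero]
  refine Module.Projective.of_forall_exists_eqOn_chain hF hF' a fun n => ?_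
  obtain ⟨N, hN⟩ := hbound n
  refine ⟨∑ m ∈ Finset.range N, (F m).subtype ∘ₗ ψ m, N, fun x hx => ?_, fun x => ?_⟩
  · have hsum : r x = ∑ m ∈ Finset.range N, DirectSum.lof B ℕ (fun n => F n) m (r x m) := by
      ext m : 1
      by_cases hm : m < N
      · rw [DFinsupp.finsetSum_apply, Finset.sum_eq_single m]
        · exact (DirectSum.lof_apply (M := fun n => F n) B m (r x m)).symm
        · intro j _ hj
          exact DirectSum.of_eq_of_ne _ _ _ hj.symm
        · exact fun h => absurd (Finset.mem_range.2 hm) h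
      · rw [DFinsupp.finsetSum_apply, hN x hx m (not_lt.1 hm), Finset.sum_eq_zero]
        intro j hj
        exact DirectSum.of_eq_of_ne _ _ _ (by have := Finset.mem_range.1 hj; omega)
    conv_rhs => rw [← hr x, hsum, map_sum]
    simp only [LinearMap.sum_apply, LinearMap.comp_apply, hψ', sumMap_lof, Submodule.subtype_apply]
  · rw [LinearMap.sum_apply]
    exact Submodule.sum_mem _ fun m hm =>
      hF (Finset.mem_range.1 hm).le (ψ m (a x)).2

end Filtered

/-- **Lemma 5.1(1)**. Condition (CI) implies condition (CII). -/
theorem condCI_implies_condCII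
    (k B : Type) [Field k] [Ring B] [Algebra k B] [FiniteDimensional k B]
    (hCI : CondCI B) : CondCII B := by
  intro X hX hfilt
  have : IsNoetherianRing B := isNoetherian_of_tower k inferInstance
  obtain ⟨F, hF, hF', hfin⟩ := hfilt.exists_chain
  have hext := hCI (fun n => ModuleCat.of B (F n)) hfin X
    (CountablyGenerated.of_chain hF' fun n => (hfin n).1) hX 1 le_rfl
  have hsub : Subsingleton (((Ext ℤ (ModuleCat.{0} B) 1).obj (Opposite.op X)).obj
      (ModuleCat.of B (DirectSum ℕ fun n => F n))) :=
    @Equiv.subsingleton _ _ (((Ext ℤ (ModuleCat.{0} B) 1).obj (Opposite.op X)).mapIso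
      (ModuleCat.coprodIsoDirectSum fun n => ModuleCat.of B (F n))).toLinearEquiv.toEquiv.symm hext
  obtain ⟨r, hr⟩ := (shortExact_of_exact _ _ (telescopeMap_injective hF)
    (sumMap_surjective hF')
    (exact_telescopeMap_sumMap hF)).exists_section_of_subsingleton_ext hsub
  exact hX.1.projective_of_section hF hF' hfin r.hom fun x => ConcreteCategory.congr_hom hr x
end

section
/- Let B be a finite-dimensional algebra over a field k. If B has finite finitistic dimension, or if B is virtually Gorenstein, then condition (CI) holds for B. (Lemma 5.1(2).) -/
open CategoryTheory
section ExtVanishing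

variable {B : Type} [Ring B]

/-- A projective resolution of a module, given by linear data. -/
structure ModuleResolution (X : ModuleCat.{0} B) where
  /-- the terms of the resolution -/
  obj : ℕ → ModuleCat.{0} B
  /-- the differentials -/
  d : ∀ n, obj (n + 1) ⟶ obj n
  /-- the augmentation -/
  aug : obj 0 ⟶ X
  projective : ∀ n, Module.Projective B (obj n)
  exact_succ : ∀ n, LinearMap.range (d (n + 1)).hom = LinearMap.ker (d n).hom
  exact_zero : LinearMap.range (d 0).hom = LinearMap.ker aug.hom
  surjective : Function.Surjective aug.hom

namespace ModuleResolution

variable {X : ModuleCat.{0} B} (R : ModuleResolution X)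

lemma d_comp_d (n : ℕ) : R.d (n + 1) ≫ R.d n = 0 := by
  ext x
  have : (R.d (n + 1)).hom x ∈ LinearMap.ker (R.d n).hom :=
    R.exact_succ n ▸ LinearMap.mem_range_self _ x
  simpa using this

lemma d_comp_aug : R.d 0 ≫ R.aug = 0 := by
  ext x
  have : (R.d 0).hom x ∈ LinearMap.ker R.aug.hom :=
    R.exact_zero ▸ LinearMap.mem_range_self _ x
  simpa using this

/-- The chain complex underlying a resolution. -/
noncomputable def complex : ChainComplex (ModuleCat.{0} B) ℕ :=
  ChainComplex.of R.obj R.d R.d_comp_d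

lemma complex_d (n : ℕ) : R.complex.d (n + 1) n = R.d n :=
  ChainComplex.of_d _ _ _

lemma complex_exactAt_succ (n : ℕ) : R.complex.ExactAt (n + 1) := by
  rw [HomologicalComplex.exactAt_iff' _ (n + 2) (n + 1) n (by simp) (by simp),
    ShortComplex.moduleCat_exact_iff_range_eq_ker]
  change LinearMap.range (R.complex.d (n + 1 + 1) (n + 1)).hom =
    LinearMap.ker (R.complex.d (n + 1) n).hom
  rw [complex_d, complex_d]
  exact R.exact_succ n

/-- A resolution given by linear data is a projective resolution in the sense of category
theory. -/
noncomputable def toProjectiveResolution : ProjectiveResolution X where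
  complex := R.complex
  projective n := by
    have := R.projective n
    exact ModuleCat.projective_of_categoryTheory_projective (R.obj n)
  π := (ChainComplex.toSingle₀Equiv _ _).symm ⟨R.aug, by
    rw [complex_d]; exact R.d_comp_aug⟩
  quasiIso := ⟨fun n => by
    cases n
    · rw [ChainComplex.quasiIsoAt₀_iff, ShortComplex.quasiIso_iff_of_zeros']
      · refine (ShortComplex.exact_and_epi_g_iff_of_iso
          (S₂ := ShortComplex.mk (R.d 0) R.aug R.d_comp_aug) ?_).2 ⟨?_, ?_⟩
        · exact ShortComplex.isoMk (Iso.refl _) (Iso.refl _) (Iso.refl _)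
            (by
              change 𝟙 _ ≫ R.d 0 = R.complex.d 1 0 ≫ 𝟙 _
              rw [complex_d R 0]; exact (Category.id_comp _).trans (Category.comp_id _).symm)
            (by
              change 𝟙 _ ≫ R.aug =
                ((ChainComplex.toSingle₀Equiv R.complex X).symm ⟨R.aug, _⟩).f 0 ≫ 𝟙 _
              refine (Category.id_comp _).trans (Eq.trans ?_ (Category.comp_id _).symm)
              exact (ChainComplex.toSingle₀Equiv_symm_apply_f_zero
                (C := R.complex) (X := X) R.aug _).symm)
        · rw [ShortComplex.moduleCat_exact_iff_range_eq_ker]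
          exact R.exact_zero
        · exact (ModuleCat.epi_iff_surjective _).2 R.surjective
      all_goals rfl
    · rw [quasiIsoAt_iff_exactAt']
      · apply complex_exactAt_succ
      · apply ChainComplex.exactAt_succ_single_obj⟩

/-- Every module has a resolution. -/
lemma nonempty (X : ModuleCat.{0} B) : Nonempty (ModuleResolution X) := by
  let P := ProjectiveResolution.of X
  refine ⟨⟨P.complex.X, fun n => P.complex.d (n + 1) n, P.π.f 0, fun n => ?_, fun n => ?_, ?_, ?_⟩⟩
  · have := P.projective n
    exact ModuleCat.projective_of_module_projective _
  · exact (ShortComplex.moduleCat_exact_iff_range_eq_ker _).1 (P.exact_succ n)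
  · exact (ShortComplex.moduleCat_exact_iff_range_eq_ker _).1 P.exact₀
  · exact (ModuleCat.epi_iff_surjective (P.π.f 0)).1 inferInstance

/-- `Ext^{n+1}(X, Y)` vanishes if and only if every cocycle of degree `n + 1` of the complex
`Hom(R, Y)` is a coboundary, for a resolution `R` of `X`. -/
lemma extZero'_succ_iff (n : ℕ) (Y : ModuleCat.{0} B) :
    extZero' B (n + 1) X Y ↔ ∀ f : R.obj (n + 1) →ₗ[B] Y, f ∘ₗ (R.d (n + 1)).hom = 0 →
      ∃ g : R.obj n →ₗ[B] Y, f = g ∘ₗ (R.d n).hom := by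
  have e := R.toProjectiveResolution.isoExt (R := ℤ) (n + 1) Y
  have h₁ : extZero' B (n + 1) X Y ↔
      (R.complex.linearYonedaObj ℤ Y).ExactAt (n + 1) := by
    rw [HomologicalComplex.exactAt_iff_isZero_homology, ModuleCat.isZero_iff_subsingleton]
    exact e.toLinearEquiv.toEquiv.subsingleton_congr
  rw [h₁, HomologicalComplex.exactAt_iff' _ n (n + 1) (n + 2) (by simp) (by simp),
    ShortComplex.moduleCat_exact_iff]
  have h₂ : ∀ m (f : R.obj m ⟶ Y), ((R.complex.linearYonedaObj ℤ Y).d m (m + 1)).hom f =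
      R.d m ≫ f := by
    intro m f
    rw [← complex_d]
    rfl
  constructor
  · intro h f hf
    obtain ⟨g, hg⟩ := h (ModuleCat.ofHom f)
      ((h₂ (n + 1) _).trans (ModuleCat.hom_ext hf : R.d (n + 1) ≫ ModuleCat.ofHom f = 0))
    have hg' : R.d n ≫ (g : R.obj n ⟶ Y) = ModuleCat.ofHom f := (h₂ n g).symm.trans hg
    exact ⟨(g : R.obj n ⟶ Y).hom, (congrArg ModuleCat.Hom.hom hg').symm⟩
  · intro h (f : R.obj (n + 1) ⟶ Y) hf
    have hf' : R.d (n + 1) ≫ f = 0 := (h₂ (n + 1) f).symm.trans hf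
    obtain ⟨g, hg⟩ := h f.hom (congrArg ModuleCat.Hom.hom hf')
    exact ⟨ModuleCat.ofHom g, (h₂ n (ModuleCat.ofHom g)).trans
      (ModuleCat.hom_ext hg.symm : R.d n ≫ ModuleCat.ofHom g = f)⟩

open DirectSum in
/-- The direct sum of a family of resolutions. -/
noncomputable def directSum {ι : Type} {X : ι → ModuleCat.{0} B}
    (R : ∀ i, ModuleResolution (X i)) {Z : ModuleCat.{0} B} (e : (⨁ i, X i) ≃ₗ[B] Z) :
    ModuleResolution Z where
  obj n := ModuleCat.of B (⨁ i, (R i).obj n)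
  d n := ModuleCat.ofHom (lmap fun i => ((R i).d n).hom)
  aug := ModuleCat.ofHom (e.toLinearMap ∘ₗ lmap fun i => (R i).aug.hom)
  projective n := by
    have := fun i => (R i).projective n
    exact Module.Projective.directSum
  exact_succ n := by
    simp only [ModuleCat.hom_ofHom, range_lmap, ker_lmap, (R _).exact_succ n]
  exact_zero := by
    rw [ModuleCat.hom_ofHom, ModuleCat.hom_ofHom, LinearEquiv.ker_comp]
    simp only [range_lmap, ker_lmap, (R _).exact_zero]
  surjective := by
    rw [ModuleCat.hom_ofHom, LinearMap.coe_comp]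
    exact e.surjective.comp ((lmap_surjective _).2 fun i => (R i).surjective)

end ModuleResolution

/-- Vanishing of `Ext^{n+1}(-, E)` is inherited by coproducts. -/
lemma extZero'_succ_coproduct {X : ℕ → ModuleCat.{0} B} {E : ModuleCat.{0} B} (n : ℕ)
    (h : ∀ i, extZero' B (n + 1) (X i) E) : extZero' B (n + 1) (∐ X) E := by
  obtain ⟨R⟩ : Nonempty (∀ i, ModuleResolution (X i)) :=
    Classical.nonempty_pi.2 fun i => ModuleResolution.nonempty (X i)
  rw [(ModuleResolution.directSum R
    (ModuleCat.coprodIsoDirectSum X).symm.toLinearEquiv).extZero'_succ_iff]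
  intro (f : DirectSum ℕ (fun i => (R i).obj (n + 1)) →ₗ[B] E)
    (hf : f ∘ₗ DirectSum.lmap (fun i => ((R i).d (n + 1)).hom) = 0)
  have key : ∀ i, ∃ g : (R i).obj n →ₗ[B] E,
      f ∘ₗ DirectSum.lof B ℕ (fun i => (R i).obj (n + 1)) i = g ∘ₗ ((R i).d n).hom := by
    intro i
    refine ((R i).extZero'_succ_iff n E).1 (h i) _ ?_
    ext x
    have := LinearMap.congr_fun hf
      (DirectSum.lof B ℕ (fun i => (R i).obj (n + 2)) i x)
    simpa using this
  choose g hg using key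
  have hfg : f = DirectSum.toModule B ℕ E g ∘ₗ DirectSum.lmap (fun i => ((R i).d n).hom) := by
    refine DirectSum.linearMap_ext _ fun i => ?_
    rw [hg]
    ext x
    simp
  exact ⟨DirectSum.toModule B ℕ E g, hfg⟩

end ExtVanishing

section HomExact

variable {B : Type} [Ring B] {P : ℤ → ModuleCat.{0} B} {d : ∀ i : ℤ, P i ⟶ P (i + 1)}

variable (d) in
/-- Every cocycle of the complex `Hom(P, M)` is a coboundary. -/
def HomExact (M : Type) [AddCommGroup M] [Module B M] : Prop :=
  ∀ (i : ℤ) (φ : P (i + 1) →ₗ[B] M), φ ∘ₗ (d i).hom = 0 →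
    ∃ ψ : P (i + 1 + 1) →ₗ[B] M, φ = ψ ∘ₗ (d (i + 1)).hom

lemma HomExact.of_retract {M N : Type} [AddCommGroup M] [Module B M] [AddCommGroup N]
    [Module B N] (h : HomExact d M) (s : N →ₗ[B] M) (r : M →ₗ[B] N)
    (hrs : r ∘ₗ s = LinearMap.id) : HomExact d N := by
  intro i φ hφ
  obtain ⟨ψ, hψ⟩ := h i (s ∘ₗ φ) (by rw [LinearMap.comp_assoc, hφ, LinearMap.comp_zero])
  refine ⟨r ∘ₗ ψ, ?_⟩
  rw [LinearMap.comp_assoc, ← hψ, ← LinearMap.comp_assoc, hrs, LinearMap.id_comp]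

lemma HomExact.pi {ι : Type} {M : ι → Type} [∀ i, AddCommGroup (M i)] [∀ i, Module B (M i)]
    (h : ∀ i, HomExact d (M i)) : HomExact d (∀ i, M i) := by
  intro i φ hφ
  have key : ∀ j, ∃ ψ : P (i + 1 + 1) →ₗ[B] M j,
      LinearMap.proj j ∘ₗ φ = ψ ∘ₗ (d (i + 1)).hom := fun j =>
    h j i _ (by rw [LinearMap.comp_assoc, hφ, LinearMap.comp_zero])
  choose ψ hψ using key
  exact ⟨LinearMap.pi ψ, LinearMap.ext fun x => funext fun j => LinearMap.congr_fun (hψ j) x⟩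

lemma HomExact.of_shortExact {K Q Y : Type} [AddCommGroup K] [Module B K] [AddCommGroup Q]
    [Module B Q] [AddCommGroup Y] [Module B Y] (hP : ∀ i, Module.Projective B (P i))
    (hd : ∀ i, LinearMap.range (d i).hom = LinearMap.ker (d (i + 1)).hom)
    {f : K →ₗ[B] Q} {g : Q →ₗ[B] Y} (hf : Function.Injective f) (hfg : Function.Exact f g)
    (hg : Function.Surjective g) (hK : HomExact d K) (hQ : HomExact d Q) : HomExact d Y := by
  intro i φ hφ
  obtain ⟨j, rfl⟩ : ∃ j, i = j + 1 := ⟨i - 1, by ring⟩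
  have hdd : (d (j + 1)).hom ∘ₗ (d j).hom = 0 :=
    LinearMap.range_le_ker_iff.1 (hd j).le
  have := hP (j + 1 + 1)
  obtain ⟨φ', hφ'⟩ := Module.projective_lifting_property g φ hg
  have hker : ∀ x, (φ' ∘ₗ (d (j + 1)).hom) x ∈ LinearMap.range f := fun x =>
    (hfg _).1 (by
      have h₁ := LinearMap.congr_fun hφ' ((d (j + 1)).hom x)
      have h₂ := LinearMap.congr_fun hφ x
      exact h₁.trans h₂)
  let e := LinearEquiv.ofInjective f hf
  let κ₀ : P (j + 1) →ₗ[B] K := e.symm.toLinearMap ∘ₗ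
    LinearMap.codRestrict (LinearMap.range f) (φ' ∘ₗ (d (j + 1)).hom) hker
  have hκ₀ : f ∘ₗ κ₀ = φ' ∘ₗ (d (j + 1)).hom := by
    ext x
    exact congrArg Subtype.val (e.apply_symm_apply ⟨_, hker x⟩)
  obtain ⟨κ, hκ⟩ := hK j κ₀ (by
    refine LinearMap.ext fun x => hf ?_
    have h₁ := LinearMap.congr_fun hκ₀ ((d j).hom x)
    have h₂ := LinearMap.congr_fun hdd x
    simp only [LinearMap.comp_apply, LinearMap.zero_apply, map_zero] at h₁ h₂ ⊢
    rw [h₁, h₂, map_zero])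
  obtain ⟨ψ, hψ⟩ := hQ (j + 1) (φ' - f ∘ₗ κ) (by
    rw [LinearMap.sub_comp, LinearMap.comp_assoc, ← hκ, hκ₀, sub_self])
  refine ⟨g ∘ₗ ψ, ?_⟩
  rw [LinearMap.comp_assoc, ← hψ, LinearMap.comp_sub, hφ', ← LinearMap.comp_assoc,
    hfg.linearMap_comp_eq_zero, LinearMap.zero_comp, sub_zero]

end HomExact

section FiniteDimensional

variable {B : Type} [Ring B]

/-- Over a finite-dimensional algebra `B`, the direct sum of copies of `B` is a direct summand
of the corresponding product. -/
lemma exists_retraction_pi_finsupp (k : Type) [Field k] [Algebra k B]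
    [FiniteDimensional k B] (ι : Type) :
    ∃ r : (ι → B) →ₗ[B] (ι →₀ B), ∀ x : ι →₀ B, r x = x := by
  obtain ⟨ρ, hρ⟩ := (Finsupp.lcoeFun : (ι →₀ k) →ₗ[k] ι → k).exists_leftInverse_of_injective
    (LinearMap.ker_eq_bot.2 DFunLike.coe_injective)
  have hρ' : ∀ x : ι →₀ k, ρ x = x := fun x => LinearMap.congr_fun hρ x
  let e := Module.finBasis k B
  -- the `k`-linear retraction obtained coordinatewise from `ρ`
  let r₀ : (ι → B) → (ι →₀ B) := fun f => ∑ j, (ρ fun i => e.coord j (f i)).mapRange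
    (fun c => c • e j) (zero_smul k _)
  have hr₀ : ∀ f i, r₀ f i = ∑ j, (ρ fun i => e.coord j (f i)) i • e j := by
    intro f i
    simp [r₀, Finsupp.finsetSum_apply]
  have coord_mul : ∀ (b x : B) (l), e.coord l (b * x) =
      ∑ j, e.coord l (b * e j) * e.coord j x := by
    intro b x l
    conv_lhs => rw [← e.sum_repr x, Finset.mul_sum, map_sum]
    refine Finset.sum_congr rfl fun j _ => ?_
    rw [mul_smul_comm, map_smul, smul_eq_mul, mul_comm]
    rfl
  refine ⟨⟨⟨r₀, fun f g => ?_⟩, fun b f => ?_⟩, fun x => ?_⟩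
  · ext i
    have : ∀ j, (fun i => e.coord j ((f + g) i)) =
        (fun i => e.coord j (f i)) + fun i => e.coord j (g i) := fun j => by
      ext i; simp
    simp only [Finsupp.add_apply, hr₀, this, map_add, add_smul, Finset.sum_add_distrib]
  · ext i
    have : ∀ l, (fun i => e.coord l ((b • f) i)) =
        ∑ j, e.coord l (b * e j) • fun i => e.coord j (f i) := fun l => by
      ext i
      simp only [Pi.smul_apply, smul_eq_mul, Finset.sum_apply]
      exact coord_mul b (f i) l
    simp only [RingHom.id_apply, Finsupp.smul_apply, hr₀, this, map_sum, map_smul,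
      Finsupp.finsetSum_apply, smul_eq_mul, Finset.sum_smul, Finset.mul_sum]
    rw [Finset.sum_comm]
    refine Finset.sum_congr rfl fun j _ => ?_
    rw [mul_smul_comm]
    conv_rhs => rw [← e.sum_repr (b * e j), Finset.smul_sum]
    refine Finset.sum_congr rfl fun l _ => ?_
    rw [smul_smul, mul_comm]
    rfl
  · ext i
    change r₀ x i = x i
    have : ∀ j, (fun i => e.coord j (x i)) =
        (x.mapRange (e.coord j) (map_zero _) : ι →₀ k) := fun j => by
      ext i; simp
    simp only [hr₀, this, hρ', Finsupp.mapRange_apply]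
    exact e.sum_repr (x i)

variable {P : ℤ → ModuleCat.{0} B} {d : ∀ i : ℤ, P i ⟶ P (i + 1)}

lemma HomExact.of_projective (k : Type) [Field k] [Algebra k B] [FiniteDimensional k B]
    (h : HomExact d B) (M : Type) [AddCommGroup M] [Module B M]
    [Module.Projective B M] : HomExact d M := by
  obtain ⟨s, hs⟩ := Module.projective_def'.1 (inferInstance : Module.Projective B M)
  obtain ⟨r, hr⟩ := exists_retraction_pi_finsupp (B := B) k M
  exact ((HomExact.pi fun _ : M => h).of_retract Finsupp.lcoeFun r
    (LinearMap.ext hr)).of_retract s _ hs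

open DirectSum in
/-- A complex of projectives which is exact and stays exact under `Hom(-, B)` stays exact under
`Hom(-, M)` for every direct sum `M` of modules of bounded projective dimension. -/
lemma HomExact.directSum_of_projDimLE (k : Type) [Field k] [Algebra k B] [FiniteDimensional k B]
    (hP : ∀ i, Module.Projective B (P i))
    (hd : ∀ i, LinearMap.range (d i).hom = LinearMap.ker (d (i + 1)).hom)
    (h : HomExact d B) {ι : Type} (n : ℕ) (Y : ι → ModuleCat.{0} B)
    (hY : ∀ i, ProjDimLE B n (Y i)) : HomExact d (⨁ i, Y i) := by
  induction n generalizing Y with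
  | zero =>
    have : ∀ i, Module.Projective B (Y i) := hY
    exact HomExact.of_projective k h _
  | succ n ih =>
    choose Q hQ g hg hK using hY
    refine HomExact.of_shortExact hP hd
      (f := lmap fun i => (LinearMap.ker (g i).hom).subtype) (g := lmap fun i => (g i).hom)
      ((lmap_injective _).2 fun i => Subtype.val_injective) ?_ ((lmap_surjective _).2 hg)
      (ih _ hK) (HomExact.of_projective k h _)
    rw [LinearMap.exact_iff, range_lmap, ker_lmap]
    simp only [Submodule.range_subtype]

end FiniteDimensional

section Gorenstein

variable {B : Type} [Ring B]

/-- The left half of a complete resolution, as a resolution of the kernel in degree `0`. -/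
def ModuleResolution.ofComplete {P : ℤ → ModuleCat.{0} B} (d : ∀ i : ℤ, P i ⟶ P (i + 1))
    (hP : ∀ i, Module.Projective B (P i))
    (hd : ∀ i, LinearMap.range (d i).hom = LinearMap.ker (d (i + 1)).hom)
    {G : ModuleCat.{0} B} (e : G ≃ₗ[B] LinearMap.ker (d 0).hom) : ModuleResolution G where
  obj n := P (Int.negSucc n)
  d n := d (Int.negSucc (n + 1))
  aug := ModuleCat.ofHom (e.symm.toLinearMap ∘ₗ
    LinearMap.codRestrict (LinearMap.ker (d 0).hom) (d (Int.negSucc 0)).hom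
      fun x => (hd (Int.negSucc 0)).le ⟨x, rfl⟩)
  projective n := hP _
  exact_succ n := hd (Int.negSucc (n + 2))
  exact_zero := by
    rw [ModuleCat.hom_ofHom, LinearEquiv.ker_comp, LinearMap.ker_codRestrict]
    exact hd (Int.negSucc 1)
  surjective := by
    rw [ModuleCat.hom_ofHom, LinearMap.coe_comp]
    refine e.symm.surjective.comp fun y => ?_
    obtain ⟨x, hx⟩ := (hd (Int.negSucc 0)).ge y.2
    exact ⟨x, Subtype.ext hx⟩

open DirectSum in
/-- Gorenstein-projective modules are left `Ext`-orthogonal to direct sums of modules of bounded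
projective dimension. -/
lemma IsGProj.extZero'_succ (k : Type) [Field k] [Algebra k B] [FiniteDimensional k B]
    {G : ModuleCat.{0} B} (hG : IsGProj B G) {ι : Type} (m : ℕ)
    (Y : ι → ModuleCat.{0} B) (hY : ∀ i, ProjDimLE B m (Y i)) {Z : ModuleCat.{0} B}
    (s : Z →ₗ[B] ⨁ i, Y i) (r : (⨁ i, Y i) →ₗ[B] Z) (hrs : r ∘ₗ s = LinearMap.id) (n : ℕ) :
    extZero' B (n + 1) G Z := by
  obtain ⟨P, d, hP, hd, hB, ⟨e⟩⟩ := hG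
  have h : HomExact d B := fun i φ hφ => by
    obtain ⟨ψ, hψ⟩ := (hB i (ModuleCat.ofHom φ)).1 (ModuleCat.hom_ext hφ)
    exact ⟨ψ.hom, congrArg ModuleCat.Hom.hom hψ⟩
  have hZ : HomExact d Z :=
    (HomExact.directSum_of_projDimLE k hP hd h m Y hY).of_retract s r hrs
  rw [(ModuleResolution.ofComplete d hP hd e).extZero'_succ_iff]
  exact fun f hf => hZ (Int.negSucc (n + 2)) f hf

end Gorenstein

/-- **Lemma 5.1(2)**. If `B` has finite finitistic dimension or is virtually Gorenstein,
then condition (CI) holds for `B`. -/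
theorem condCI_of_finite_finitistic_dimension_or_virtually_gorenstein
    (k B : Type) [Field k] [Ring B] [Algebra k B] [FiniteDimensional k B]
    (h : FiniteFinitisticDim B ∨ VirtGorenstein B) : CondCI B := by
  have succ_of_pos : ∀ i : ℕ, 1 ≤ i → ∃ n, i = n + 1 := fun i hi => ⟨i - 1, by omega⟩
  intro Y hY G _ hG i hi
  rcases h with ⟨m, hm⟩ | hV
  · obtain ⟨n, rfl⟩ := succ_of_pos i hi
    exact IsGProj.extZero'_succ k hG.1 m Y (fun j => hm _ (hY j).1 (hY j).2)
      (ModuleCat.coprodIsoDirectSum Y).hom.hom (ModuleCat.coprodIsoDirectSum Y).inv.hom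
      (congrArg ModuleCat.Hom.hom (ModuleCat.coprodIsoDirectSum Y).hom_inv_id) n
  · refine (hV (∐ Y)).2 (fun E hE l hl => ?_) G hG.1 i hi
    obtain ⟨n, rfl⟩ := succ_of_pos l hl
    refine extZero'_succ_coproduct n fun j => ?_
    refine (hV (Y j)).1 (fun G' hG' l' hl' => ?_) E hE (n + 1) hl
    obtain ⟨n', rfl⟩ := succ_of_pos l' hl'
    obtain ⟨m, hm⟩ := (hY j).2
    exact IsGProj.extZero'_succ k hG' m (fun _ : Unit => Y j) (fun _ => hm)
      (DirectSum.lof B Unit (fun _ => Y j) ()) (DirectSum.component B Unit (fun _ => Y j) ())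
      (LinearMap.ext fun x => DirectSum.component.lof_self (M := fun _ : Unit => Y j) B () x) n'
end

section
/- Let k be a field, A a finite-dimensional self-injective k-algebra, and M a finitely generated self-orthogonal generator for A-mod. If X is a finitely M-filtered A-module, then: (i) Ext_A^i(G,X) = 0 for all i ≥ 1 and all G ∈ 𝒢; (ii) there is an exact sequence 0 → M_n → M_{n-1} → ⋯ → M_0 → X → 0 of A-modules with all M_j ∈ add(M) (X has an add(M)-resolution of finite length); (iii) if moreover X ∈ 𝒢, then X ∈ add(M). (Lemma on finitely M-filtered modules.) -/
open CategoryTheory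
/-! ## Additive closure classes -/

section AddClosure

variable (A : Type) [Ring A]

/-- `X ∈ add M`: `X` is a direct summand of a finite direct sum of copies of `M`. -/
def MemAdd (M X : ModuleCat.{0} A) : Prop :=
  ∃ (n : ℕ) (Y : ModuleCat.{0} A), Nonempty ((↥X × ↥Y) ≃ₗ[A] (Fin n → ↥M))

/-- `X ∈ Add M`: `X` is a direct summand of an arbitrary direct sum of copies of `M`. -/
def MemAddBig (M X : ModuleCat.{0} A) : Prop :=
  ∃ (I : Type) (Y : ModuleCat.{0} A), Nonempty ((↥X × ↥Y) ≃ₗ[A] (I →₀ ↥M))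

/-- a morphism of `A`-modules factors through a projective module -/
def FactorsThroughProj {X Y : ModuleCat.{0} A} (f : X ⟶ Y) : Prop :=
  ∃ (P : ModuleCat.{0} A) (_ : Module.Projective A P) (g : X ⟶ P) (h : P ⟶ Y), f = g ≫ h

/-- a morphism of `A`-modules factors through a module in `Add M` -/
def FactorsThroughAddM (M : ModuleCat.{0} A) {X Y : ModuleCat.{0} A} (f : X ⟶ Y) : Prop :=
  ∃ (Z : ModuleCat.{0} A) (_ : MemAddBig A M Z) (g : X ⟶ Z) (h : Z ⟶ Y), f = g ≫ h

/-- `X ∈ add M` for unbundled modules. -/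
def MemAddPlain (M : Type) [AddCommGroup M] [Module A M]
    (X : Type) [AddCommGroup X] [Module A X] : Prop :=
  ∃ (n : ℕ) (Y : ModuleCat.{0} A), Nonempty ((X × ↥Y) ≃ₗ[A] (Fin n → M))

end AddClosure

/-! ## Ext vanishing -/

section ExtDefs

variable (A : Type) [Ring A]

/-- vanishing of `Ext^n_A(X, Y)` -/
noncomputable def extZero (n : ℕ) (X Y : ModuleCat.{0} A) : Prop :=
  Subsingleton (((Ext ℤ (ModuleCat.{0} A) n).obj (Opposite.op X)).obj Y)

/-- `M` is self-orthogonal: `Ext^n_A(M,M) = 0` for all `n ≥ 1`. -/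
noncomputable def SelfOrthogonal (M : ModuleCat.{0} A) : Prop :=
  ∀ n : ℕ, 1 ≤ n → extZero A n M M

/-- `M` is a generator for `A`-mod: `A ∈ add M`. -/
def IsGen (M : ModuleCat.{0} A) : Prop :=
  MemAdd A M (ModuleCat.of A A)

/-- membership in the `M`-Gorenstein subcategory `𝒢`:
`Ext^n_A(M,X) = 0 = Ext^n_A(X,M)` for all `n ≥ 1`. -/
noncomputable def MemG (M X : ModuleCat.{0} A) : Prop :=
  ∀ n : ℕ, 1 ≤ n → extZero A n M X ∧ extZero A n X M

end ExtDefs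

/-! ## Minimal injective coresolutions, cosyzygies, `M`-filtered modules -/

section Cosyzygy

variable (A : Type) [Ring A]

/-- `ι : N ⟶ I` is an injective envelope: `I` is injective, `ι` is injective,
and the image of `ι` is an essential submodule of `I`. -/
def IsInjEnvelope {N I : ModuleCat.{0} A} (ι : N ⟶ I) : Prop :=
  Module.Injective A ↥I ∧ Function.Injective ι ∧
    ∀ K : Submodule A ↥I, K ⊓ LinearMap.range ι.hom = ⊥ → K = ⊥

/-- `C` is the sequence of cosyzygies of `M` along a minimal injective coresolution:
`C 0 ≅ M` and for each `n` there is a short exact sequence `0 → C n → I → C (n+1) → 0`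
in which `C n → I` is an injective envelope. -/
def IsMinInjCoresolution (M : ModuleCat.{0} A) (C : ℕ → ModuleCat.{0} A) : Prop :=
  Nonempty (C 0 ≅ M) ∧
    ∀ n, ∃ (I : ModuleCat.{0} A) (ι : C n ⟶ I) (p : I ⟶ C (n + 1)),
      IsInjEnvelope A ι ∧ Function.Surjective p ∧ LinearMap.range ι.hom = LinearMap.ker p.hom

/-- the family of modules `{A} ∪ {C i | i ∈ ℕ}`, indexed by `Option ℕ`. -/
def optPick (C : ℕ → ModuleCat.{0} A) : Option ℕ → ModuleCat.{0} A
  | none => ModuleCat.of A A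
  | some i => C i

/-- `Q` is isomorphic to a finite direct sum of modules from `{A} ∪ {C i | i ∈ ℕ}`. -/
def IsFinSumFrom (C : ℕ → ModuleCat.{0} A) (Q : Type) [AddCommGroup Q] [Module A Q] : Prop :=
  ∃ (m : ℕ) (T : Fin m → Option ℕ),
    Nonempty (Q ≃ₗ[A] ((j : Fin m) → ↥(optPick A C (T j))))

/-- `X` is `M`-filtered (where `C` encodes the cosyzygies `Ω_A^{-i}(M)`, `C 0 ≅ M`):
there is an ascending chain `0 = X₀ ⊆ X₁ ⊆ ⋯` of submodules with union `X` all of whose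
subquotients are finite direct sums of modules from `{A} ∪ {Ω_A^{-i}(M) | i ∈ ℕ}`. -/
def MFiltered (C : ℕ → ModuleCat.{0} A) (X : ModuleCat.{0} A) : Prop :=
  ∃ F : ℕ → Submodule A ↥X,
    Monotone F ∧ F 0 = ⊥ ∧ (⨆ n, F n) = ⊤ ∧
      ∀ n, IsFinSumFrom A C
        (↥(F (n + 1)) ⧸ (Submodule.comap (F (n + 1)).subtype (F n)))

/-- `X` is finitely `M`-filtered: as `MFiltered`, with a chain that reaches `⊤`
after finitely many steps. -/
def FinMFiltered (C : ℕ → ModuleCat.{0} A) (X : ModuleCat.{0} A) : Prop :=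
  ∃ F : ℕ → Submodule A ↥X,
    Monotone F ∧ F 0 = ⊥ ∧ (∃ n, F n = ⊤) ∧
      ∀ n, IsFinSumFrom A C
        (↥(F (n + 1)) ⧸ (Submodule.comap (F (n + 1)).subtype (F n)))

end Cosyzygy

/-! ## add(M)-resolutions of finite length -/

section Resol

variable (A : Type) [Ring A]

/-- `X` admits an `add M`-resolution `0 → M_n → ⋯ → M_0 → X → 0` of length `n`. -/
def HasAddMResLen (M : ModuleCat.{0} A) : ℕ → ModuleCat.{0} A → Prop
  | 0, X => MemAdd A M X
  | n + 1, X => ∃ (M0 : ModuleCat.{0} A) (_ : MemAdd A M M0) (g : M0 ⟶ X),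
      Function.Surjective g ∧ HasAddMResLen M n (ModuleCat.of A ↥(LinearMap.ker g.hom))

end Resol


/-! ## Self-injective rings: annihilators and embeddings into free modules -/

section SelfInjective

variable {A : Type} [Ring A]

/-- Over a self-injective ring, an element killed by the left annihilator of finitely many
elements lies in the right ideal they generate. -/
theorem exists_sum_mul_eq_of_annihilates [Module.Injective A A] {n : ℕ} (w : Fin n → A) (x : A)
    (h : ∀ a, (∀ i, a * w i = 0) → a * x = 0) : ∃ b : Fin n → A, x = ∑ i, w i * b i := by
  let φ : A →ₗ[A] (Fin n → A) := LinearMap.toSpanSingleton A (Fin n → A) w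
  let ψ : A →ₗ[A] A := LinearMap.toSpanSingleton A A x
  have hle : LinearMap.ker φ ≤ LinearMap.ker ψ := by
    intro a ha
    exact h a fun i ↦ congrFun (show a • w = 0 from ha) i
  obtain ⟨e, he⟩ := Module.Injective.extension_property A A _ _
    ((LinearMap.ker φ).liftQ φ le_rfl)
    (LinearMap.ker_eq_bot.mp (Submodule.ker_liftQ_eq_bot _ _ _ le_rfl))
    ((LinearMap.ker φ).liftQ ψ hle)
  refine ⟨fun i ↦ e (Pi.single i 1), ?_⟩
  have h1 := LinearMap.congr_fun he (Submodule.Quotient.mk 1)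
  simp only [LinearMap.comp_apply, Submodule.liftQ_apply, φ, ψ,
    LinearMap.toSpanSingleton_apply, one_smul] at h1
  rw [← h1]
  conv_lhs => rw [pi_eq_sum_univ' w]
  simp [map_sum]

/-- Over a finite-dimensional self-injective algebra, every two-sided ideal is the right
annihilator of its left annihilator. -/
theorem mem_of_annihilator_annihilates (k : Type) [Field k] [Algebra k A] [FiniteDimensional k A]
    [Module.Injective A A] (I : Ideal A) [I.IsTwoSided] {x : A}
    (h : ∀ a ∈ Module.annihilator A I, a * x = 0) : x ∈ I := by
  let b := Module.finBasis k (I.restrictScalars k)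
  obtain ⟨c, hc⟩ := exists_sum_mul_eq_of_annihilates (fun i ↦ (b i : A)) x fun a ha ↦ by
    refine h a (Module.mem_annihilator.mpr fun y ↦ Subtype.ext ?_)
    have hy := congrArg Subtype.val (b.sum_repr (⟨y.1, y.2⟩ : I.restrictScalars k))
    change a * y.1 = 0
    simp only [AddSubmonoidClass.coe_finsetSum, Submodule.coe_smul] at hy
    rw [← hy, Finset.mul_sum]
    exact Finset.sum_eq_zero fun i _ ↦ by rw [mul_smul_comm, ha, smul_zero]
  rw [hc]
  exact I.sum_mem fun i _ ↦ I.mul_mem_right _ (b i).2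

theorem annihilator_injective (k : Type) [Field k] [Algebra k A] [FiniteDimensional k A]
    [Module.Injective A A] {I I' : Ideal A} [I.IsTwoSided] [I'.IsTwoSided]
    (h : Module.annihilator A I = Module.annihilator A I') : I = I' := by
  apply le_antisymm
  · exact fun x hx ↦ mem_of_annihilator_annihilates k I' fun a ha ↦
      congrArg Subtype.val (Module.mem_annihilator.mp (h ▸ ha) ⟨x, hx⟩)
  · exact fun x hx ↦ mem_of_annihilator_annihilates k I fun a ha ↦
      congrArg Subtype.val (Module.mem_annihilator.mp (h.symm ▸ ha) ⟨x, hx⟩)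

theorem mem_annihilator_ideal {I : Ideal A} {a : A} :
    a ∈ Module.annihilator A I ↔ ∀ x ∈ I, a * x = 0 := by
  rw [Module.mem_annihilator]
  exact ⟨fun h x hx ↦ congrArg Subtype.val (h ⟨x, hx⟩), fun h x ↦ Subtype.ext (h x.1 x.2)⟩

theorem annihilator_ideal_antitone : Antitone fun I : Ideal A ↦ Module.annihilator A I :=
  fun _ _ h _ ha ↦ mem_annihilator_ideal.mpr fun x hx ↦ mem_annihilator_ideal.mp ha x (h hx)

theorem mem_jacobson_of_forall_isNilpotent {I : Ideal A} (h : ∀ x ∈ I, IsNilpotent x) :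
    I ≤ Ring.jacobson A := by
  refine le_sInf fun m hm ↦ ?_
  by_contra hI
  have htop : I ⊔ m = ⊤ := hm.2 _ (lt_of_le_of_ne le_sup_right fun e ↦ hI (e ▸ le_sup_left))
  obtain ⟨x, hx, y, hy, hxy⟩ := Submodule.mem_sup.mp (htop ▸ Submodule.mem_top : (1 : A) ∈ I ⊔ m)
  have hu : IsUnit y := by
    rw [← eq_sub_iff_add_eq'] at hxy
    exact hxy ▸ (h x hx).isUnit_one_sub
  exact hm.1 (Ideal.eq_top_of_isUnit_mem m hy hu)

/-- Every product `y * r₁ * ⋯ * rᵢ` with factors `rⱼ ∈ J` vanishes. -/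
def RightKilledBy (J : Ideal A) : ℕ → A → Prop
  | 0, y => y = 0
  | i + 1, y => ∀ r ∈ J, RightKilledBy J i (y * r)

/-- The iterated left annihilator of a nilpotent ideal consists of nilpotent elements. -/
theorem isNilpotent_of_mem_annihilator_annihilator {J : Ideal A} (hJ : IsNilpotent J)
    {x : A} (hx : x ∈ Module.annihilator A (Module.annihilator A J)) : IsNilpotent x := by
  have hshift : ∀ (i : ℕ) (y : A), RightKilledBy J (i + 1) y → RightKilledBy J i (x * y) := by
    intro i
    induction i with
    | zero => exact fun y hy ↦ mem_annihilator_ideal.mp hx y (mem_annihilator_ideal.mpr hy)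
    | succ i ih =>
      intro y hy r hr
      rw [mul_assoc]
      exact ih _ (hy r hr)
  have hpow : ∀ (i : ℕ) (y : A), RightKilledBy J i y → x ^ i * y = 0 := by
    intro i
    induction i with
    | zero => exact fun y hy ↦ (pow_zero x).symm ▸ (one_mul y).trans hy
    | succ i ih =>
      intro y hy
      rw [pow_succ, mul_assoc]
      exact ih _ (hshift i y hy)
  obtain ⟨m, hm⟩ := hJ
  have hmem : ∀ i j : ℕ, J ^ (i + j + 1) = 0 → ∀ y ∈ J ^ (j + 1), RightKilledBy J i y := by
    intro i
    induction i with
    | zero =>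
      intro j h y hy
      rw [zero_add] at h
      rw [h] at hy
      exact (Submodule.mem_bot A).mp hy
    | succ i ih =>
      intro j h y hy r hr
      refine ih (j + 1) (by rw [← h]; congr 1; ring) _ ?_
      rw [Submodule.pow_succ]
      exact Ideal.mul_mem_mul hy hr
  refine ⟨m + 1, ?_⟩
  rw [← mul_one (x ^ (m + 1))]
  refine hpow (m + 1) 1 fun r hr ↦ hmem m 0 ?_ _ ?_
  · rw [add_zero, Submodule.pow_succ, hm, zero_mul]
  · rwa [one_mul, Submodule.pow_one]

/-- Over a finite-dimensional self-injective algebra the Jacobson radical is the left annihilator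
of the right socle. -/
theorem annihilator_annihilator_jacobson (k : Type) [Field k] [Algebra k A]
    [FiniteDimensional k A] [Module.Injective A A] :
    Module.annihilator A (Module.annihilator A (Ring.jacobson A)) = Ring.jacobson A := by
  have : IsArtinianRing A := IsArtinianRing.of_finite k A
  let J := Ring.jacobson A
  let f : Ideal A → Ideal A := fun I ↦ Module.annihilator A (Module.annihilator A I)
  have hf : Monotone f := fun _ _ h ↦ annihilator_ideal_antitone (annihilator_ideal_antitone h)
  have hJ : f J ≤ J := mem_jacobson_of_forall_isNilpotent fun x hx ↦
    isNilpotent_of_mem_annihilator_annihilator IsSemiprimaryRing.isNilpotent hx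
  have hts : ∀ n, (f^[n] J).IsTwoSided
    | 0 => inferInstanceAs (Ring.jacobson A).IsTwoSided
    | n + 1 => by
      rw [Function.iterate_succ_apply']
      exact inferInstanceAs (Module.annihilator A _).IsTwoSided
  obtain ⟨n, hn⟩ := IsArtinian.monotone_stabilizes
    (⟨fun n ↦ OrderDual.toDual (f^[n] J), fun _ _ h ↦
      hf.antitone_iterate_of_map_le hJ h⟩ : ℕ →o (Submodule A A)ᵒᵈ)
  have hstab : f^[n + 1] J = f^[n] J := (hn (n + 1) n.le_succ).symm
  clear hn
  induction n with
  | zero => exact hstab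
  | succ n ih =>
    apply ih
    have := hts n
    have := hts (n + 1)
    rw [Function.iterate_succ_apply' f (n + 1), Function.iterate_succ_apply' f n] at hstab
    rw [Function.iterate_succ_apply' f n] at this ⊢
    exact annihilator_injective k (annihilator_injective k hstab)

/-- Every simple module over a finite-dimensional self-injective algebra embeds into it. -/
theorem exists_injective_of_isSimpleModule (k : Type) [Field k] [Algebra k A]
    [FiniteDimensional k A] [Module.Injective A A]
    (S : Type) [AddCommGroup S] [Module A S] [IsSimpleModule A S] :
    ∃ f : S →ₗ[A] A, Function.Injective f := by
  have : IsArtinianRing A := IsArtinianRing.of_finite k A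
  have := IsSimpleModule.nontrivial A S
  obtain ⟨s, hs⟩ := exists_ne (0 : S)
  have hss : IsSemisimpleModule A (A ⧸ Ring.jacobson A) :=
    (IsArtinian.isSemisimpleModule_iff_jacobson A _).mpr
      (Module.jacobson_quotient_jacobson A A)
  let π : (A ⧸ Ring.jacobson A) →ₗ[A] S := (Ring.jacobson A).liftQ (LinearMap.toSpanSingleton A S s)
    (IsSemisimpleModule.jacobson_le_ker A A A S _)
  have hπ : π ≠ 0 := fun h ↦ hs <|
    (one_smul A s).symm.trans (LinearMap.congr_fun h (Submodule.Quotient.mk 1))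
  obtain ⟨K, ⟨e⟩⟩ := LinearMap.linearEquiv_of_ne_zero hπ
  obtain ⟨a, ha⟩ := Submodule.Quotient.mk_surjective _ (e s).1
  have haJ : a ∉ Ring.jacobson A := fun h ↦ hs (by
    rw [(Submodule.Quotient.mk_eq_zero _).mpr h] at ha
    exact e.map_eq_zero_iff.mp (Subtype.ext ha.symm))
  rw [← annihilator_annihilator_jacobson k, mem_annihilator_ideal] at haJ
  push Not at haJ
  obtain ⟨w, hw, haw⟩ := haJ
  let ρ : (A ⧸ Ring.jacobson A) →ₗ[A] A := (Ring.jacobson A).liftQ (LinearMap.toSpanSingleton A A w)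
    fun x hx ↦ by
      rw [← annihilator_annihilator_jacobson k] at hx
      exact mem_annihilator_ideal.mp hx w hw
  refine ⟨ρ ∘ₗ K.subtype ∘ₗ e.toLinearMap, LinearMap.injective_of_ne_zero fun h ↦ haw ?_⟩
  have h1 : ρ (e s).1 = 0 := LinearMap.congr_fun h s
  rwa [← ha] at h1

/-- A finite-dimensional self-injective algebra cogenerates its modules. -/
theorem exists_linearMap_apply_ne_zero (k : Type) [Field k] [Algebra k A]
    [FiniteDimensional k A] [Module.Injective A A]
    {N : Type} [AddCommGroup N] [Module A N] {x : N} (hx : x ≠ 0) :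
    ∃ f : N →ₗ[A] A, f x ≠ 0 := by
  let φ := LinearMap.toSpanSingleton A N x
  have hφ : LinearMap.ker φ ≠ ⊤ := fun h ↦ hx (by
    simpa [φ] using (h ▸ Submodule.mem_top : (1 : A) ∈ LinearMap.ker φ))
  obtain ⟨m, hm, hle⟩ := Ideal.exists_le_maximal _ hφ
  have : IsSimpleModule A (A ⧸ m) := isSimpleModule_iff_isCoatom.mpr hm.out
  obtain ⟨g, hg⟩ := exists_injective_of_isSimpleModule (A := A) k (A ⧸ m)
  obtain ⟨f, hf⟩ := Module.Injective.extension_property A A _ _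
    ((LinearMap.ker φ).liftQ φ le_rfl)
    (LinearMap.ker_eq_bot.mp (Submodule.ker_liftQ_eq_bot _ _ _ le_rfl))
    (g ∘ₗ Submodule.factor hle)
  refine ⟨f, fun h ↦ hm.ne_top ((Ideal.eq_top_iff_one m).mpr ?_)⟩
  have h1 := LinearMap.congr_fun hf (Submodule.Quotient.mk 1)
  simp only [LinearMap.comp_apply, Submodule.liftQ_apply, φ,
    LinearMap.toSpanSingleton_apply, one_smul, h] at h1
  exact (Submodule.Quotient.mk_eq_zero m).mp (hg (h1.symm.trans (map_zero g).symm))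

theorem exists_injective_to_pi (k : Type) [Field k] [Algebra k A]
    [FiniteDimensional k A] [Module.Injective A A]
    (N : Type) [AddCommGroup N] [Module A N] [Module.Finite A N] :
    ∃ (n : ℕ) (f : N →ₗ[A] (Fin n → A)), Function.Injective f := by
  have : IsArtinianRing A := IsArtinianRing.of_finite k A
  obtain ⟨K, ⟨n, f, rfl⟩, hmin⟩ := IsArtinian.set_has_minimal
    {K : Submodule A N | ∃ (n : ℕ) (f : N →ₗ[A] (Fin n → A)), LinearMap.ker f = K}
    ⟨_, 0, 0, rfl⟩
  refine ⟨n, f, LinearMap.ker_eq_bot.mp ((Submodule.eq_bot_iff _).mpr fun x hx ↦ ?_)⟩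
  by_contra hx0
  obtain ⟨g, hg⟩ := exists_linearMap_apply_ne_zero (A := A) k hx0
  let f' : N →ₗ[A] (Fin (n + 1) → A) :=
    (Fin.consLinearEquiv A fun _ : Fin (n + 1) ↦ A).toLinearMap ∘ₗ g.prod f
  have hker : LinearMap.ker f' = LinearMap.ker g ⊓ LinearMap.ker f := by
    rw [← LinearMap.ker_prod, LinearEquiv.ker_comp]
  refine hmin _ ⟨n + 1, f', rfl⟩ (lt_of_le_of_ne (hker ▸ inf_le_right) fun h ↦ hg ?_)
  exact (hker ▸ h.symm ▸ hx : x ∈ LinearMap.ker g ⊓ LinearMap.ker f).1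

end SelfInjective

/-! ## Ext vanishing through projective resolutions -/

section ExtVanishing

variable {A : Type} [Ring A]

theorem extZero_succ_iff {X : ModuleCat.{0} A} (P : ProjectiveResolution X) (n : ℕ)
    (Y : ModuleCat.{0} A) :
    extZero A (n + 1) X Y ↔ ∀ f : P.complex.X (n + 1) ⟶ Y,
      P.complex.d (n + 2) (n + 1) ≫ f = 0 → ∃ g : P.complex.X n ⟶ Y,
        P.complex.d (n + 1) n ≫ g = f := by
  rw [extZero, ← ModuleCat.isZero_iff_subsingleton, (P.isoExt (R := ℤ) (n + 1) Y).isZero_iff,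
    ← HomologicalComplex.exactAt_iff_isZero_homology,
    HomologicalComplex.exactAt_iff' _ n (n + 1) (n + 2) (by simp) (by simp),
    ShortComplex.moduleCat_exact_iff]
  rfl

/-- The dimension shift in the second variable, at the level of vanishing. -/
theorem extZero_of_shortExact {G K Y Z : ModuleCat.{0} A} (f : K ⟶ Y) (g : Y ⟶ Z)
    (hf : Function.Injective f) (hg : Function.Surjective g)
    (hfg : LinearMap.range f.hom = LinearMap.ker g.hom) {i : ℕ} (hi : 1 ≤ i)
    (hY : extZero A i G Y) (hK : extZero A (i + 1) G K) : extZero A i G Z := by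
  obtain ⟨i, rfl⟩ := Nat.exists_eq_add_of_le' hi
  let P := projectiveResolution G
  have : Epi g := (ModuleCat.epi_iff_surjective g).mpr hg
  have : Mono f := (ModuleCat.mono_iff_injective f).mpr hf
  have hw : f ≫ g = 0 := by
    ext x
    exact (hfg ▸ LinearMap.mem_range_self f.hom x : f.hom x ∈ LinearMap.ker g.hom)
  have hex : (ShortComplex.mk f g hw).Exact :=
    (ShortComplex.moduleCat_exact_iff_range_eq_ker _).mpr hfg
  rw [extZero_succ_iff P] at hY hK ⊢
  intro u hu
  let v := Projective.factorThru u g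
  have hv : v ≫ g = u := Projective.factorThru_comp u g
  have hdv : (P.complex.d (i + 2) (i + 1) ≫ v) ≫ g = 0 := by rw [Category.assoc, hv, hu]
  let t : P.complex.X (i + 2) ⟶ K := hex.lift _ hdv
  have ht : t ≫ f = P.complex.d (i + 2) (i + 1) ≫ v := hex.lift_f _ hdv
  obtain ⟨s, hs⟩ := hK t (by
    rw [← cancel_mono f, Category.assoc, ht, ← Category.assoc, P.complex.d_comp_d]
    simp)
  obtain ⟨r, hr⟩ := hY (v - s ≫ f) (by
    rw [Preadditive.comp_sub, ← ht, ← hs, Category.assoc, sub_self])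
  refine ⟨r ≫ g, ?_⟩
  rw [← Category.assoc, hr, Preadditive.sub_comp, hv, Category.assoc, hw, Limits.comp_zero,
    sub_zero]

/-- Vanishing of the first Ext group lifts morphisms through epimorphisms. -/
theorem exists_lift_of_extZero_one {X K Y Z : ModuleCat.{0} A} (f : K ⟶ Y) (g : Y ⟶ Z)
    (hf : Function.Injective f) (hg : Function.Surjective g)
    (hfg : LinearMap.range f.hom = LinearMap.ker g.hom)
    (h : extZero A 1 X K) (u : X ⟶ Z) : ∃ v : X ⟶ Y, v ≫ g = u := by
  let P := projectiveResolution X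
  have : Epi g := (ModuleCat.epi_iff_surjective g).mpr hg
  have : Mono f := (ModuleCat.mono_iff_injective f).mpr hf
  have hw : f ≫ g = 0 := by
    ext x
    exact (hfg ▸ LinearMap.mem_range_self f.hom x : f.hom x ∈ LinearMap.ker g.hom)
  have hex : (ShortComplex.mk f g hw).Exact :=
    (ShortComplex.moduleCat_exact_iff_range_eq_ker _).mpr hfg
  rw [extZero_succ_iff P] at h
  let π : P.complex.X 0 ⟶ X := P.π.f 0
  have hdπ : P.complex.d 1 0 ≫ π = 0 := P.complex_d_comp_π_f_zero
  let v := Projective.factorThru (π ≫ u) g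
  have hv : v ≫ g = π ≫ u := Projective.factorThru_comp _ g
  have hdv : (P.complex.d 1 0 ≫ v) ≫ g = 0 := by
    rw [Category.assoc, hv, ← Category.assoc, hdπ, Limits.zero_comp]
  let t : P.complex.X 1 ⟶ K := hex.lift _ hdv
  have ht : t ≫ f = P.complex.d 1 0 ≫ v := hex.lift_f _ hdv
  obtain ⟨s, hs⟩ := h t (by
    rw [← cancel_mono f, Category.assoc, ht, ← Category.assoc, P.complex.d_comp_d]
    simp)
  have hπ : Epi π := inferInstanceAs (Epi (P.π.f 0))
  have hd : P.complex.d 1 0 ≫ (v - s ≫ f) = 0 := by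
    rw [Preadditive.comp_sub, ← ht, ← hs, Category.assoc, sub_self]
  let q : X ⟶ Y := P.exact₀.desc (v - s ≫ f) hd
  have hq : π ≫ q = v - s ≫ f := P.exact₀.g_desc _ hd
  refine ⟨q, ?_⟩
  rw [← cancel_epi π, ← Category.assoc, hq, Preadditive.sub_comp, hv, Category.assoc, hw,
    Limits.comp_zero, sub_zero]

end ExtVanishing

/-! ## The class `add M` -/

section AddClass

variable {A : Type} [Ring A] {M : ModuleCat.{0} A}

/-- `X ∈ add M` iff `X` is a retract of a finite power of `M`. -/
theorem memAdd_iff {X : ModuleCat.{0} A} : MemAdd A M X ↔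
    ∃ (ι : Type) (_ : Finite ι) (s : X →ₗ[A] (ι → M)) (r : (ι → M) →ₗ[A] X),
      r ∘ₗ s = LinearMap.id := by
  constructor
  · rintro ⟨n, Y, ⟨e⟩⟩
    exact ⟨Fin n, inferInstance, e.toLinearMap ∘ₗ LinearMap.inl A X Y,
      LinearMap.fst A X Y ∘ₗ e.symm.toLinearMap, by ext; simp⟩
  · rintro ⟨ι, _, s, r, h⟩
    obtain ⟨n, ⟨e⟩⟩ := Finite.exists_equiv_fin ι
    exact ⟨n, ModuleCat.of A (LinearMap.ker r),
      ⟨(LinearEquiv.prodComm A _ _).trans ((lequivProdOfRightSplitExact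
        (LinearMap.ker r).injective_subtype (LinearMap.ker r).range_subtype h).trans
          (LinearEquiv.funCongrLeft A M e.symm))⟩⟩

theorem MemAdd.of_retract {X Y : ModuleCat.{0} A} (hX : MemAdd A M X) (s : Y →ₗ[A] X)
    (r : X →ₗ[A] Y) (h : r ∘ₗ s = LinearMap.id) : MemAdd A M Y := by
  obtain ⟨ι, hι, s', r', h'⟩ := memAdd_iff.mp hX
  refine memAdd_iff.mpr ⟨ι, hι, s' ∘ₗ s, r ∘ₗ r', ?_⟩
  rw [LinearMap.comp_assoc, ← LinearMap.comp_assoc s, h', LinearMap.id_comp, h]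

theorem MemAdd.of_linearEquiv {X Y : ModuleCat.{0} A} (hX : MemAdd A M X) (e : X ≃ₗ[A] Y) :
    MemAdd A M Y :=
  hX.of_retract e.symm.toLinearMap e.toLinearMap (by ext; simp)

theorem memAdd_of_subsingleton (X : ModuleCat.{0} A) [Subsingleton X] : MemAdd A M X :=
  memAdd_iff.mpr ⟨Empty, inferInstance, 0, 0, by ext; exact Subsingleton.elim _ _⟩

theorem memAdd_self : MemAdd A M M :=
  memAdd_iff.mpr ⟨Unit, inferInstance, LinearMap.pi fun _ ↦ LinearMap.id, LinearMap.proj (),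
    by ext; simp⟩

theorem MemAdd.pi {ι : Type} [Finite ι] {X : ι → ModuleCat.{0} A} (h : ∀ i, MemAdd A M (X i)) :
    MemAdd A M (ModuleCat.of A (∀ i, X i)) := by
  choose κ hκ s r hsr using fun i ↦ memAdd_iff.mp (h i)
  refine memAdd_iff.mpr ⟨Σ i, κ i, inferInstance,
    LinearMap.pi fun p ↦ LinearMap.proj p.2 ∘ₗ s p.1 ∘ₗ LinearMap.proj p.1,
    LinearMap.pi fun i ↦ r i ∘ₗ LinearMap.funLeft A M (Sigma.mk i), ?_⟩
  refine LinearMap.ext fun x ↦ funext fun i ↦ ?_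
  exact LinearMap.congr_fun (hsr i) (x i)

theorem MemAdd.prod {X Y : ModuleCat.{0} A} (hX : MemAdd A M X) (hY : MemAdd A M Y) :
    MemAdd A M (ModuleCat.of A (X × Y)) := by
  obtain ⟨ι, _, s, r, h⟩ := memAdd_iff.mp hX
  obtain ⟨κ, _, s', r', h'⟩ := memAdd_iff.mp hY
  let e := LinearEquiv.sumArrowLequivProdArrow ι κ A M
  refine memAdd_iff.mpr ⟨ι ⊕ κ, inferInstance, e.symm.toLinearMap ∘ₗ s.prodMap s',
    r.prodMap r' ∘ₗ e.toLinearMap, LinearMap.ext fun x ↦ ?_⟩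
  have h1 := LinearMap.congr_fun h x.1
  have h2 := LinearMap.congr_fun h' x.2
  simp only [LinearMap.comp_apply, LinearMap.id_apply] at h1 h2
  simp [h1, h2]

/-- Modules in `add M` inherit the vanishing of Ext into `M`. -/
theorem MemAdd.extZero {G X : ModuleCat.{0} A} (hX : MemAdd A M X) {i : ℕ} (hi : 1 ≤ i)
    (h : extZero A i G M) : extZero A i G X := by
  obtain ⟨i, rfl⟩ := Nat.exists_eq_add_of_le' hi
  let P := projectiveResolution G
  rw [extZero_succ_iff P] at h ⊢
  obtain ⟨ι, _, s, r, hrs⟩ := memAdd_iff.mp hX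
  intro f hf
  choose g hg using fun j : ι ↦ h (f ≫ ModuleCat.ofHom (LinearMap.proj j ∘ₗ s)) (by
    rw [← Category.assoc, hf, Limits.zero_comp])
  refine ⟨ModuleCat.ofHom (r ∘ₗ LinearMap.pi fun j ↦ (g j).hom), ?_⟩
  ext x
  have hx : (fun j ↦ (g j).hom ((P.complex.d (i + 1) i).hom x)) = s (f.hom x) :=
    funext fun j ↦ LinearMap.congr_fun (congrArg ModuleCat.Hom.hom (hg j)) x
  change r (fun j ↦ (g j).hom ((P.complex.d (i + 1) i).hom x)) = f.hom x
  rw [hx]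
  exact LinearMap.congr_fun hrs _

/-- Morphisms from modules in `add M` lift through surjections whose kernel `K` has
`Ext¹(M, K) = 0`. -/
theorem MemAdd.exists_lift {X K Y Z : ModuleCat.{0} A} (hX : MemAdd A M X)
    (f : K ⟶ Y) (g : Y ⟶ Z)
    (hf : Function.Injective f) (hg : Function.Surjective g)
    (hfg : LinearMap.range f.hom = LinearMap.ker g.hom)
    (h : _root_.extZero A 1 M K) (u : X ⟶ Z) : ∃ v : X ⟶ Y, v ≫ g = u := by
  classical
  obtain ⟨ι, _, s, r, hrs⟩ := memAdd_iff.mp hX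
  have := Fintype.ofFinite ι
  choose v hv using fun j : ι ↦ exists_lift_of_extZero_one f g hf hg hfg h
    (ModuleCat.ofHom (u.hom ∘ₗ r ∘ₗ LinearMap.single A (fun _ ↦ M) j))
  let w : (ι → M) →ₗ[A] Y := LinearMap.lsum A (fun _ ↦ M) ℕ fun j ↦ (v j).hom
  have hw : g.hom ∘ₗ w = u.hom ∘ₗ r := by
    refine LinearMap.pi_ext' fun j ↦ ?_
    refine Eq.trans ?_ (congrArg ModuleCat.Hom.hom (hv j))
    ext x
    have hwx : w (Pi.single j x) = (v j).hom x := by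
      simp only [w, LinearMap.lsum_apply, LinearMap.sum_apply, LinearMap.comp_apply,
        LinearMap.proj_apply]
      rw [Finset.sum_eq_single j (fun i _ hij ↦ by simp [Pi.single_eq_of_ne hij]) (by simp)]
      simp
    exact congrArg g.hom hwx
  refine ⟨ModuleCat.ofHom (w ∘ₗ s), ?_⟩
  ext x
  exact (LinearMap.congr_fun hw (s x)).trans (congrArg u.hom (LinearMap.congr_fun hrs x))

end AddClass

/-! ## Finite `add M`-resolutions -/

section FiniteResolutions

variable {A : Type} [Ring A] {M : ModuleCat.{0} A}

theorem HasAddMResLen.of_linearEquiv {n : ℕ} : ∀ {X Y : ModuleCat.{0} A},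
    HasAddMResLen A M n X → (X ≃ₗ[A] Y) → HasAddMResLen A M n Y := by
  induction n with
  | zero => exact fun hX e ↦ MemAdd.of_linearEquiv hX e
  | succ n ih =>
    rintro X Y ⟨M₀, hM₀, g, hg, hK⟩ e
    refine ⟨M₀, hM₀, g ≫ ModuleCat.ofHom e.toLinearMap, e.surjective.comp hg, ih hK ?_⟩
    exact LinearEquiv.ofEq _ _ (LinearEquiv.ker_comp e g.hom).symm

theorem HasAddMResLen.succ_of_shortExact {n : ℕ} {K Y Z : ModuleCat.{0} A} (f : K ⟶ Y) (g : Y ⟶ Z)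
    (hf : Function.Injective f) (hg : Function.Surjective g)
    (hfg : LinearMap.range f.hom = LinearMap.ker g.hom) (hY : MemAdd A M Y)
    (hK : HasAddMResLen A M n K) : HasAddMResLen A M (n + 1) Z :=
  ⟨Y, hY, g, hg, hK.of_linearEquiv
    ((LinearEquiv.ofInjective f.hom hf).trans (LinearEquiv.ofEq _ _ hfg))⟩

theorem HasAddMResLen.succ {n : ℕ} : ∀ {X : ModuleCat.{0} A},
    HasAddMResLen A M n X → HasAddMResLen A M (n + 1) X := by
  induction n with
  | zero =>
    refine fun {X} hX ↦ ⟨X, hX, 𝟙 X, Function.surjective_id, ?_⟩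
    have : Subsingleton (LinearMap.ker (𝟙 X : X ⟶ X).hom) := by
      rw [Submodule.subsingleton_iff_eq_bot]
      exact LinearMap.ker_id
    exact memAdd_of_subsingleton (ModuleCat.of A (LinearMap.ker (𝟙 X : X ⟶ X).hom))
  | succ n ih =>
    rintro X ⟨M₀, hM₀, g, hg, hK⟩
    exact ⟨M₀, hM₀, g, hg, ih hK⟩

theorem HasAddMResLen.mono {m n : ℕ} (hmn : m ≤ n) {X : ModuleCat.{0} A}
    (h : HasAddMResLen A M m X) : HasAddMResLen A M n X :=
  Nat.le_induction h (fun _ _ ↦ HasAddMResLen.succ) n hmn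

/-- A module with a finite `add M`-resolution is right Ext-orthogonal to every module that is
left Ext-orthogonal to `M`. -/
theorem HasAddMResLen.extZero {G : ModuleCat.{0} A} (hG : ∀ i, 1 ≤ i → extZero A i G M) {n : ℕ} :
    ∀ {X : ModuleCat.{0} A}, HasAddMResLen A M n X → ∀ i, 1 ≤ i → _root_.extZero A i G X := by
  induction n with
  | zero => exact fun hX i hi ↦ MemAdd.extZero hX hi (hG i hi)
  | succ n ih =>
    rintro X ⟨M₀, hM₀, g, hg, hK⟩ i hi
    exact extZero_of_shortExact (ModuleCat.ofHom (LinearMap.ker g.hom).subtype) g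
      (LinearMap.ker g.hom).injective_subtype hg (LinearMap.ker g.hom).range_subtype hi
      (hM₀.extZero hi (hG i hi)) (ih hK (i + 1) (by lia))

/-- Horseshoe lemma: for self-orthogonal `M`, modules with an `add M`-resolution of length `n` are
closed under extensions. -/
theorem HasAddMResLen.of_extension (hM : SelfOrthogonal A M) {n : ℕ} :
    ∀ {K Y Z : ModuleCat.{0} A} (f : K ⟶ Y) (g : Y ⟶ Z),
      Function.Injective f → Function.Surjective g →
      LinearMap.range f.hom = LinearMap.ker g.hom →
      HasAddMResLen A M n K → HasAddMResLen A M n Z → HasAddMResLen A M n Y := by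
  induction n with
  | zero =>
    intro K Y Z f g hf hg hfg hK hZ
    obtain ⟨s, hs⟩ := MemAdd.exists_lift hZ f g hf hg hfg
      (HasAddMResLen.extZero hM hK 1 le_rfl) (𝟙 Z)
    exact MemAdd.of_linearEquiv (MemAdd.prod hK hZ)
      (lequivProdOfRightSplitExact hf hfg (congrArg ModuleCat.Hom.hom hs))
  | succ n ih =>
    intro K Y Z f g hf hg hfg hK hZ
    have hext := HasAddMResLen.extZero hM hK 1 le_rfl
    obtain ⟨K₀, hK₀, p, hp, hK'⟩ := hK
    obtain ⟨Z₀, hZ₀, q, hq, hZ'⟩ := hZ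
    obtain ⟨t, ht⟩ := hZ₀.exists_lift f g hf hg hfg hext q
    have hgt : ∀ b, g.hom (t.hom b) = q.hom b :=
      LinearMap.congr_fun (congrArg ModuleCat.Hom.hom ht)
    have hgf : ∀ x, g.hom (f.hom x) = 0 := fun x ↦
      (hfg ▸ LinearMap.mem_range_self f.hom x : f.hom x ∈ LinearMap.ker g.hom)
    have hrange : ∀ y, g.hom y = 0 → ∃ a, f.hom (p.hom a) = y := by
      intro y hy
      obtain ⟨x, rfl⟩ := (hfg.symm ▸ hy : y ∈ LinearMap.range f.hom)
      obtain ⟨a, rfl⟩ := hp x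
      exact ⟨a, rfl⟩
    let φ : (K₀ × Z₀) →ₗ[A] Y := (f.hom ∘ₗ p.hom).coprod t.hom
    have hφ : ∀ c, φ c = f.hom (p.hom c.1) + t.hom c.2 := fun c ↦ rfl
    have hq' : ∀ c ∈ LinearMap.ker φ, c.2 ∈ LinearMap.ker q.hom := by
      intro c hc
      have := congrArg g.hom ((hφ c).symm.trans hc)
      rwa [map_add, hgf, zero_add, hgt, map_zero] at this
    have hp' : ∀ a ∈ LinearMap.ker p.hom, LinearMap.inl A K₀ Z₀ a ∈ LinearMap.ker φ := by
      intro a ha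
      have ha : p.hom a = 0 := ha
      simp [φ, ha]
    refine ⟨ModuleCat.of A (K₀ × Z₀), hK₀.prod hZ₀, ModuleCat.ofHom φ, ?_,
      ih (ModuleCat.ofHom ((LinearMap.inl A K₀ Z₀).restrict hp'))
        (ModuleCat.ofHom ((LinearMap.snd A K₀ Z₀).restrict hq')) ?_ ?_ ?_ hK' hZ'⟩
    · intro y
      obtain ⟨b, hb⟩ := hq (g y)
      obtain ⟨a, ha⟩ := hrange (y - t.hom b) (by
        rw [map_sub, hgt]
        exact sub_eq_zero.mpr hb.symm)
      exact ⟨(a, b), (hφ _).trans (by rw [ha, sub_add_cancel])⟩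
    · intro a b hab
      exact Subtype.ext (LinearMap.inl_injective (congrArg Subtype.val hab))
    · intro b
      obtain ⟨a, ha⟩ := hrange (-t.hom b.1) (by
        rw [map_neg, hgt, neg_eq_zero]
        exact b.2)
      exact ⟨⟨(a, b.1), (hφ _).trans (by rw [ha, neg_add_cancel])⟩, rfl⟩
    · ext c
      constructor
      · rintro ⟨a, rfl⟩
        rfl
      · intro hc
        have hc2 : c.1.2 = 0 := congrArg Subtype.val hc
        have hc1 : p.hom c.1.1 = 0 := hf (by
          have := (hφ c.1).symm.trans c.2
          rw [hc2, map_zero, add_zero] at this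
          exact this.trans (map_zero f.hom).symm)
        exact ⟨⟨c.1.1, hc1⟩, Subtype.ext (Prod.ext rfl hc2.symm)⟩

theorem exists_hasAddMResLen_of_extension (hM : SelfOrthogonal A M) {K Y Z : ModuleCat.{0} A}
    (f : K ⟶ Y) (g : Y ⟶ Z) (hf : Function.Injective f) (hg : Function.Surjective g)
    (hfg : LinearMap.range f.hom = LinearMap.ker g.hom)
    (hK : ∃ n, HasAddMResLen A M n K) (hZ : ∃ n, HasAddMResLen A M n Z) :
    ∃ n, HasAddMResLen A M n Y := by
  obtain ⟨m, hK⟩ := hK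
  obtain ⟨n, hZ⟩ := hZ
  exact ⟨max m n, HasAddMResLen.of_extension hM f g hf hg hfg (hK.mono (le_max_left m n))
    (hZ.mono (le_max_right m n))⟩

theorem exists_hasAddMResLen_pi (hM : SelfOrthogonal A M) {m : ℕ} :
    ∀ {T : Fin m → ModuleCat.{0} A}, (∀ j, ∃ n, HasAddMResLen A M n (T j)) →
      ∃ n, HasAddMResLen A M n (ModuleCat.of A (∀ j, T j)) := by
  induction m with
  | zero => exact fun _ ↦ ⟨0, memAdd_of_subsingleton _⟩
  | succ m ih =>
    intro T hT
    obtain ⟨n, hn⟩ := exists_hasAddMResLen_of_extension hM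
      (ModuleCat.ofHom (LinearMap.inl A (T 0) (∀ j : Fin m, T j.succ)))
      (ModuleCat.ofHom (LinearMap.snd A (T 0) (∀ j : Fin m, T j.succ)))
      LinearMap.inl_injective LinearMap.snd_surjective (LinearMap.range_inl A _ _)
      (hT 0) (ih fun j ↦ hT j.succ)
    exact ⟨n, hn.of_linearEquiv (Fin.consLinearEquiv A fun j ↦ T j)⟩

/-- A module with a finite `add M`-resolution that is left Ext-orthogonal to `M` is in `add M`. -/
theorem HasAddMResLen.memAdd {X : ModuleCat.{0} A} (hX : ∀ i, 1 ≤ i → _root_.extZero A i X M)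
    {n : ℕ} (h : HasAddMResLen A M n X) : MemAdd A M X := by
  cases n with
  | zero => exact h
  | succ n =>
    obtain ⟨M₀, hM₀, g, hg, hK⟩ := h
    obtain ⟨s, hs⟩ := exists_lift_of_extZero_one
      (ModuleCat.ofHom (LinearMap.ker g.hom).subtype) g (LinearMap.ker g.hom).injective_subtype hg
      (LinearMap.ker g.hom).range_subtype (hK.extZero hX 1 le_rfl) (𝟙 X)
    exact hM₀.of_retract s.hom g.hom (congrArg ModuleCat.Hom.hom hs)

end FiniteResolutions

/-! ## Cosyzygies and filtered modules -/

section Filtered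

variable {A : Type} [Ring A] {M : ModuleCat.{0} A}

/-- Injective envelopes of finitely generated modules over a finite-dimensional self-injective
algebra are in `add A`. -/
theorem IsInjEnvelope.memAdd (k : Type) [Field k] [Algebra k A] [FiniteDimensional k A]
    [Module.Injective A A] {N I : ModuleCat.{0} A} [Module.Finite A N] {ι : N ⟶ I}
    (h : IsInjEnvelope A ι) : MemAdd A (ModuleCat.of A A) I := by
  obtain ⟨hI, hι, hess⟩ := h
  obtain ⟨n, f, hf⟩ := exists_injective_to_pi (A := A) k N
  obtain ⟨s, hs⟩ := Module.Injective.extension_property A (Fin n → A) N I ι.hom hι f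
  have hs' : Function.Injective s := by
    refine LinearMap.ker_eq_bot.mp (hess _ ((Submodule.eq_bot_iff _).mpr ?_))
    rintro _ ⟨hx, y, rfl⟩
    have : f y = 0 := (LinearMap.congr_fun hs y).symm.trans hx
    rw [hf (this.trans (map_zero f).symm), map_zero]
  obtain ⟨r, hr⟩ := Module.Injective.extension_property A I I (Fin n → A) s hs' LinearMap.id
  exact memAdd_iff.mpr ⟨Fin n, inferInstance, s, r, hr⟩

theorem MemAdd.trans {X Y : ModuleCat.{0} A} (hX : MemAdd A Y X) (hY : MemAdd A M Y) :
    MemAdd A M X := by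
  obtain ⟨ι, _, s, r, h⟩ := memAdd_iff.mp hX
  exact (MemAdd.pi fun _ : ι ↦ hY).of_retract s r h

theorem MemAdd.finite {X : ModuleCat.{0} A} [Module.Finite A M] (hX : MemAdd A M X) :
    Module.Finite A X := by
  obtain ⟨ι, _, s, r, h⟩ := memAdd_iff.mp hX
  exact Module.Finite.of_surjective r fun x ↦ ⟨s x, LinearMap.congr_fun h x⟩

/-- The `i`-th cosyzygy of `M` is finitely generated with an `add M`-resolution of length `i`. -/
theorem IsMinInjCoresolution.finite_and_hasAddMResLen (k : Type) [Field k] [Algebra k A]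
    [FiniteDimensional k A] [Module.Injective A A] [Module.Finite A M] (hgen : IsGen A M)
    {C : ℕ → ModuleCat.{0} A} (hC : IsMinInjCoresolution A M C) (i : ℕ) :
    Module.Finite A (C i) ∧ HasAddMResLen A M i (C i) := by
  obtain ⟨⟨e⟩, hC⟩ := hC
  induction i with
  | zero =>
    exact ⟨Module.Finite.equiv e.symm.toLinearEquiv, memAdd_self.of_linearEquiv e.symm.toLinearEquiv⟩
  | succ i ih =>
    obtain ⟨_, hi⟩ := ih
    obtain ⟨I, ι, p, henv, hp, hιp⟩ := hC i
    have hI := IsInjEnvelope.memAdd k henv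
    have : Module.Finite A I := hI.finite
    exact ⟨Module.Finite.of_surjective p.hom hp,
      hi.succ_of_shortExact ι p henv.2.1 hp hιp (hI.trans hgen)⟩

theorem FinMFiltered.exists_hasAddMResLen (hM : SelfOrthogonal A M) (hgen : IsGen A M)
    {C : ℕ → ModuleCat.{0} A} (hC : ∀ i, HasAddMResLen A M i (C i))
    {X : ModuleCat.{0} A} (hX : FinMFiltered A C X) : ∃ n, HasAddMResLen A M n X := by
  obtain ⟨F, hF, hF0, ⟨N, hN⟩, hsub⟩ := hX
  have hstep : ∀ m, ∃ n, HasAddMResLen A M n (ModuleCat.of A (F m)) := by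
    intro m
    induction m with
    | zero =>
      have : Subsingleton (F 0) := Submodule.subsingleton_iff_eq_bot.mpr hF0
      exact ⟨0, memAdd_of_subsingleton (ModuleCat.of A (F 0))⟩
    | succ m ih =>
      obtain ⟨l, T, ⟨e⟩⟩ := hsub m
      obtain ⟨n, hn⟩ := exists_hasAddMResLen_pi hM (T := fun j ↦ optPick A C (T j)) fun j ↦ by
        cases T j with
        | none => exact ⟨0, hgen⟩
        | some i => exact ⟨i, hC i⟩
      refine exists_hasAddMResLen_of_extension hM
        (ModuleCat.ofHom (Submodule.inclusion (hF m.le_succ)))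
        (ModuleCat.ofHom (Submodule.comap (F (m + 1)).subtype (F m)).mkQ)
        (Submodule.inclusion_injective (hF m.le_succ)) (Submodule.mkQ_surjective _) ?_ ih
        ⟨n, hn.of_linearEquiv e.symm⟩
      exact (Submodule.range_inclusion _ _ (hF m.le_succ)).trans (Submodule.ker_mkQ _).symm
  obtain ⟨n, hn⟩ := hstep N
  exact ⟨n, hn.of_linearEquiv ((LinearEquiv.ofEq _ _ hN).trans Submodule.topEquiv)⟩

end Filtered

/-- **Lemma on finitely `M`-filtered modules**. A finitely `M`-filtered module `X` satisfies
`Ext_A^i(G,X) = 0` for all `i ≥ 1` and `G ∈ 𝒢`, admits an `add M`-resolution of finite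
length, and lies in `add M` whenever it belongs to `𝒢`. -/
theorem finitely_M_filtered_properties
    (k A : Type) [Field k] [Ring A] [Algebra k A] [FiniteDimensional k A]
    [Module.Injective A A]
    (M : ModuleCat.{0} A) [Module.Finite A ↥M]
    (hgen : IsGen A M) (hso : SelfOrthogonal A M)
    (C : ℕ → ModuleCat.{0} A) (hC : IsMinInjCoresolution A M C)
    (X : ModuleCat.{0} A) (hX : FinMFiltered A C X) :
    (∀ G : ModuleCat.{0} A, MemG A M G → ∀ i : ℕ, 1 ≤ i → extZero A i G X) ∧
    (∃ n, HasAddMResLen A M n X) ∧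
    (MemG A M X → MemAdd A M X) := by
  obtain ⟨n, hn⟩ := FinMFiltered.exists_hasAddMResLen hso hgen
    (fun i ↦ (IsMinInjCoresolution.finite_and_hasAddMResLen k hgen hC i).2) hX
  exact ⟨fun G hG ↦ hn.extZero fun i hi ↦ (hG i hi).2, ⟨n, hn⟩,
    fun hXG ↦ hn.memAdd fun i hi ↦ (hXG i hi).2⟩
end
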